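/- For b ∈ ℤ_{>0}^n with b_1 ≥ 2, the h-polynomial of X_n(b) equals the binomial Eulerian polynomial Ã_n(z) = 1 + z·∑_{k=1}^{n} C(n,k)·A_k(z), where A_k(z) = ∑_{σ ∈ S_k} z^{des(σ)} is the Eulerian polynomial; for b_1 = 1 the h-polynomial equals Ã_n(z) - n·z·A_{n-1}(z). -/

import Mathlib

open Polynomial

/-- Partial sum `S_i = b_1 + ⋯ + b_i`, where `b j` denotes `b_{j+1}` (0-indexed). -/
def Spart (b : ℕ → ℕ) (i : ℕ) : ℕ := ∑ j ∈ Finset.range i, b j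

/-- A `b`-parking function. -/
def IsBParkingFunction (n : ℕ) (b : ℕ → ℕ) (β : Fin n → ℕ) : Prop :=
  (∀ i, 1 ≤ β i) ∧ ∃ σ : Equiv.Perm (Fin n),
    Monotone (β ∘ σ) ∧ ∀ i : Fin n, β (σ i) ≤ Spart b ((i : ℕ) + 1)

/-- The `b`-parking-function polytope. -/
noncomputable def bpfPolytope (n : ℕ) (b : ℕ → ℕ) : Set (Fin n → ℝ) :=
  convexHull ℝ {x | ∃ β : Fin n → ℕ, IsBParkingFunction n b β ∧ x = fun i => (β i : ℝ)}

/-- The number of `k`-dimensional faces of the `b`-parking-function polytope. -/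
noncomputable def faceCount (n : ℕ) (b : ℕ → ℕ) (k : ℕ) : ℕ :=
  {F : Set (Fin n → ℝ) | F.Nonempty ∧ IsExposed ℝ (bpfPolytope n b) F ∧
    Module.finrank ℝ (vectorSpan ℝ F) = k}.ncard

/-- The number of descents of a permutation of `{0,…,m-1}`. -/
noncomputable def descentsCount {m : ℕ} (σ : Equiv.Perm (Fin m)) : ℕ :=
  Nat.card {i : Fin m // ∃ h : (i : ℕ) + 1 < m, σ ⟨(i : ℕ) + 1, h⟩ < σ i}

/-- The Eulerian polynomial `A_k(z) = ∑_{σ ∈ S_k} z^{des σ}`. -/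
noncomputable def eulerianPoly (k : ℕ) : Polynomial ℤ :=
  ∑ σ : Equiv.Perm (Fin k), X ^ descentsCount σ

/-- The binomial Eulerian polynomial `Ã_n(z) = 1 + z ∑_{k=1}^n C(n,k) A_k(z)`. -/
noncomputable def binomialEulerianPoly (n : ℕ) : Polynomial ℤ :=
  1 + X * ∑ k ∈ Finset.Icc 1 n, (n.choose k : Polynomial ℤ) * eulerianPoly k

section PartialSums

lemma Spart_lt {n : ℕ} {b : ℕ → ℕ} (hb : ∀ j < n, 1 ≤ b j) {i j : ℕ} (hij : i < j)
    (hj : j ≤ n) : Spart b i < Spart b j := by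
  unfold Spart
  refine Finset.sum_lt_sum_of_subset (i := i) (Finset.range_mono hij.le) ?_ ?_ ?_ ?_
  · simpa using hij
  · simp
  · exact hb i (by omega)
  · intros; exact Nat.zero_le _

lemma Spart_le {b : ℕ → ℕ} {i j : ℕ} (hij : i ≤ j) : Spart b i ≤ Spart b j :=
  Finset.sum_le_sum_of_subset (Finset.range_mono hij)

lemma one_le_Spart {n : ℕ} {b : ℕ → ℕ} (hb : ∀ j < n, 1 ≤ b j) {i : ℕ} (hi : 0 < i)
    (hin : i ≤ n) : 1 ≤ Spart b i := by
  have := Spart_lt hb hi hin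
  omega

/-- The sum of the `k` largest of the partial sums `S_1, …, S_n`. -/
def topSum (n : ℕ) (b : ℕ → ℕ) (k : ℕ) : ℝ := ∑ j ∈ Finset.range k, (Spart b (n - j) : ℝ)

lemma topSum_succ (n : ℕ) (b : ℕ → ℕ) (k : ℕ) :
    topSum n b (k + 1) = topSum n b k + Spart b (n - k) := by
  simp [topSum, Finset.sum_range_succ]

lemma topSum_add_lt {n : ℕ} {b : ℕ → ℕ} (hb : ∀ j < n, 1 ≤ b j) {p q r : ℕ} (hq : 0 < q)
    (hr : 0 < r) (h : p + q + r ≤ n) :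
    topSum n b (p + q + r) + topSum n b p < topSum n b (p + q) + topSum n b (p + r) := by
  have key : ∀ m k, topSum n b (m + k) =
      topSum n b m + ∑ j ∈ Finset.range k, (Spart b (n - (m + j)) : ℝ) := by
    intro m k
    simp only [topSum, Finset.sum_range_add]
  rw [key (p + q) r, key p r]
  have : ∑ j ∈ Finset.range r, (Spart b (n - (p + q + j)) : ℝ) <
      ∑ j ∈ Finset.range r, (Spart b (n - (p + j)) : ℝ) := by
    refine Finset.sum_lt_sum_of_nonempty (by simpa using hr.ne') ?_
    intro j hj
    rw [Finset.mem_range] at hj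
    exact_mod_cast Spart_lt hb (by omega) (by omega)
  linarith

lemma topSum_union_inter_lt {n : ℕ} {b : ℕ → ℕ} (hb : ∀ j < n, 1 ≤ b j)
    {C D : Finset (Fin n)} (h₁ : ¬ C ⊆ D) (h₂ : ¬ D ⊆ C) :
    topSum n b (C ∪ D).card + topSum n b (C ∩ D).card <
      topSum n b C.card + topSum n b D.card := by
  have hC := Finset.card_sdiff_add_card_inter C D
  have hD := Finset.card_sdiff_add_card_inter D C
  have hU := Finset.card_union_add_card_inter C D
  have hn := Finset.card_le_univ (C ∪ D)
  rw [Fintype.card_fin] at hn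
  rw [Finset.inter_comm D C] at hD
  have hq : 0 < (C \ D).card := Finset.card_pos.2 (Finset.sdiff_nonempty.2 h₁)
  have hr : 0 < (D \ C).card := Finset.card_pos.2 (Finset.sdiff_nonempty.2 h₂)
  have := topSum_add_lt hb (p := (C ∩ D).card) hq hr (by omega)
  convert this using 3 <;> omega

lemma sum_Spart_le_topSum {n : ℕ} {b : ℕ → ℕ} (D : Finset ℕ) (hD : ∀ k ∈ D, k < n) :
    ∑ k ∈ D, (Spart b (k + 1) : ℝ) ≤ topSum n b D.card := by
  induction D using Finset.induction_on_min with
  | empty => simp [topSum]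
  | insert a s has ih =>
    have ha : a ∉ s := fun h => lt_irrefl _ (has a h)
    rw [Finset.sum_insert ha, Finset.card_insert_of_notMem ha, topSum_succ, add_comm]
    have hs : s.card ≤ n - (a + 1) := by
      have : s ⊆ Finset.Ico (a + 1) n := fun k hk =>
        Finset.mem_Ico.2 ⟨has k hk, hD k (Finset.mem_insert_of_mem hk)⟩
      simpa using Finset.card_le_card this
    have han : a < n := hD a (Finset.mem_insert_self _ _)
    have h := Spart_le (b := b) (i := a + 1) (j := n - s.card) (by omega)
    have h' : (Spart b (a + 1) : ℝ) ≤ Spart b (n - s.card) := by exact_mod_cast h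
    linarith [ih fun k hk => hD k (Finset.mem_insert_of_mem hk)]

lemma sum_Spart_top {n : ℕ} {b : ℕ → ℕ} {m : ℕ} (hm : m ≤ n) :
    ∑ k ∈ Finset.univ.filter (fun k : Fin n => n - m ≤ (k : ℕ)), (Spart b ((k : ℕ) + 1) : ℝ) =
      topSum n b m := by
  unfold topSum
  refine Finset.sum_bij' (fun k _ => n - 1 - (k : ℕ))
    (fun j hj => ⟨n - 1 - j, by rw [Finset.mem_range] at hj; omega⟩) ?_ ?_ ?_ ?_ ?_
  · intro k hk
    have := k.2
    simp only [Finset.mem_filter, Finset.mem_univ, true_and, Finset.mem_range] at hk ⊢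
    omega
  · intro j hj
    simp only [Finset.mem_filter, Finset.mem_univ, true_and, Finset.mem_range] at hj ⊢
    omega
  · intro k hk
    have := k.2
    ext
    simp only
    omega
  · intro j hj
    simp only [Finset.mem_range] at hj ⊢
    omega
  · intro k hk
    have := k.2
    congr 2
    omega

end PartialSums

section Inequalities

variable {n : ℕ} {b : ℕ → ℕ}

lemma one_le_of_mem_bpfPolytope {x : Fin n → ℝ} (hx : x ∈ bpfPolytope n b) (i : Fin n) :
    1 ≤ x i := by
  have hconv : Convex ℝ {y : Fin n → ℝ | 1 ≤ y i} :=
    convex_halfSpace_ge (LinearMap.proj (R := ℝ) (φ := fun _ : Fin n => ℝ) i).isLinear 1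
  refine convexHull_min ?_ hconv hx
  rintro _ ⟨β, hβ, rfl⟩
  simpa using hβ.1 i

lemma sum_le_topSum_of_mem_bpfPolytope {x : Fin n → ℝ} (hx : x ∈ bpfPolytope n b)
    (C : Finset (Fin n)) : ∑ i ∈ C, x i ≤ topSum n b C.card := by
  have hlin : IsLinearMap ℝ fun y : Fin n → ℝ => ∑ i ∈ C, y i :=
    ⟨fun y z => by simp [Finset.sum_add_distrib], fun a y => by simp [Finset.mul_sum]⟩
  refine convexHull_min ?_ (convex_halfSpace_le hlin (topSum n b C.card)) hx
  rintro _ ⟨β, ⟨-, σ, -, hσ⟩, rfl⟩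
  have h := sum_Spart_le_topSum (b := b)
    (C.map (σ.symm.toEmbedding.trans Fin.valEmbedding)) (n := n)
    (by simp only [Finset.mem_map]; rintro _ ⟨i, -, rfl⟩; simp)
  rw [Finset.card_map, Finset.sum_map] at h
  refine le_trans (Finset.sum_le_sum fun i _ => ?_) h
  have := hσ (σ.symm i)
  rw [σ.apply_symm_apply] at this
  simpa using this

/-- If `C` and `D` are tight at a point of the polytope, then they are comparable. -/
lemma subset_or_subset_of_tight (hb : ∀ j < n, 1 ≤ b j) {x : Fin n → ℝ}
    (hx : x ∈ bpfPolytope n b) {C D : Finset (Fin n)}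
    (hC : ∑ i ∈ C, x i = topSum n b C.card) (hD : ∑ i ∈ D, x i = topSum n b D.card) :
    C ⊆ D ∨ D ⊆ C := by
  by_contra! h
  have h₁ := topSum_union_inter_lt hb h.1 h.2
  have h₂ := Finset.sum_union_inter (s₁ := C) (s₂ := D) (f := x)
  have h₃ := sum_le_topSum_of_mem_bpfPolytope hx (C ∪ D)
  have h₄ := sum_le_topSum_of_mem_bpfPolytope hx (C ∩ D)
  linarith

lemma mem_iff_le_of_upperClosed {n : ℕ} {D : Finset (Fin n)}
    (hD : ∀ k ∈ D, ∀ l, k ≤ l → l ∈ D) (k : Fin n) : k ∈ D ↔ n - D.card ≤ (k : ℕ) := by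
  have hk := k.2
  constructor
  · intro h
    have : Finset.Ici k ⊆ D := fun l hl => hD k h l (Finset.mem_Ici.1 hl)
    have := Finset.card_le_card this
    rw [Fin.card_Ici] at this
    omega
  · intro h
    by_contra hkD
    have : D ⊆ Finset.Ioi k := fun l hl =>
      Finset.mem_Ioi.2 (lt_of_not_ge fun hlk => hkD (hD l hl k hlk))
    have := Finset.card_le_card this
    rw [Fin.card_Ioi] at this
    omega

lemma apply_sort_mem_iff {n : ℕ} (c : Fin n → ℤ) {A : Finset (Fin n)}
    (hA : ∀ i ∈ A, ∀ j ∉ A, c j < c i) (k : Fin n) :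
    Tuple.sort c k ∈ A ↔ n - A.card ≤ (k : ℕ) := by
  set σ := Tuple.sort c with hσ
  have hmono : Monotone (c ∘ σ) := Tuple.monotone_sort c
  have h := mem_iff_le_of_upperClosed (D := A.map σ.symm.toEmbedding) (by
    intro k hk l hkl
    simp only [Finset.mem_map_equiv, Equiv.symm_symm] at hk ⊢
    by_contra hl
    exact absurd (hmono hkl) (not_le.2 (hA _ hk _ hl))) k
  rw [Finset.card_map, Finset.mem_map_equiv, Equiv.symm_symm] at h
  exact h

end Inequalities

section Faces

variable {n : ℕ} {b : ℕ → ℕ}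

/-- A chain `𝒞` of sets containing `∅`, together with a set `N` disjoint from all of them. -/
def IsFlag (𝒞 : Finset (Finset (Fin n))) (N : Finset (Fin n)) : Prop :=
  ∅ ∈ 𝒞 ∧ IsChain (· ⊆ ·) (𝒞 : Set (Finset (Fin n))) ∧ ∀ C ∈ 𝒞, Disjoint C N

/-- The points of the polytope at which the upper bounds for the sets in `𝒞` and the lower
bounds for the coordinates in `N` are attained. -/
def flagFace (b : ℕ → ℕ) (𝒞 : Finset (Finset (Fin n))) (N : Finset (Fin n)) :
    Set (Fin n → ℝ) :=
  {x | x ∈ bpfPolytope n b ∧ (∀ C ∈ 𝒞, ∑ i ∈ C, x i = topSum n b C.card) ∧ ∀ i ∈ N, x i = 1}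

lemma IsFlag.subset_or_subset {𝒞 : Finset (Finset (Fin n))} {N : Finset (Fin n)}
    (h : IsFlag 𝒞 N) {C D : Finset (Fin n)} (hC : C ∈ 𝒞) (hD : D ∈ 𝒞) : C ⊆ D ∨ D ⊆ C :=
  h.2.1.total hC hD

lemma IsFlag.insert_left {𝒞 : Finset (Finset (Fin n))} {N : Finset (Fin n)} (h : IsFlag 𝒞 N)
    {C : Finset (Fin n)} (hC : ∀ D ∈ 𝒞, C ⊆ D ∨ D ⊆ C) (hN : Disjoint C N) :
    IsFlag (insert C 𝒞) N := by
  refine ⟨Finset.mem_insert_of_mem h.1, ?_, ?_⟩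
  · rw [Finset.coe_insert]
    exact h.2.1.insert fun D hD _ => hC D hD
  · intro D hD
    rcases Finset.mem_insert.1 hD with rfl | hD
    exacts [hN, h.2.2 D hD]

lemma IsFlag.insert_right {𝒞 : Finset (Finset (Fin n))} {N : Finset (Fin n)}
    (h : IsFlag 𝒞 N) {i : Fin n} (hi : ∀ C ∈ 𝒞, i ∉ C) : IsFlag 𝒞 (insert i N) :=
  ⟨h.1, h.2.1, fun C hC => Finset.disjoint_insert_right.2 ⟨hi C hC, h.2.2 C hC⟩⟩

lemma IsFlag.mono {𝒞 𝒟 : Finset (Finset (Fin n))} {N M : Finset (Fin n)}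
    (h : IsFlag 𝒞 N) (h𝒟 : 𝒟 ⊆ 𝒞) (h0 : ∅ ∈ 𝒟) (hM : M ⊆ N) : IsFlag 𝒟 M :=
  ⟨h0, h.2.1.mono (by exact_mod_cast h𝒟), fun C hC => (h.2.2 C (h𝒟 hC)).mono_right hM⟩

lemma IsFlag.flagFace_nonempty (hb : ∀ j < n, 1 ≤ b j) {𝒞 : Finset (Finset (Fin n))}
    {N : Finset (Fin n)} (h : IsFlag 𝒞 N) : (flagFace b 𝒞 N).Nonempty := by
  classical
  set c : Fin n → ℤ := fun i =>
    ((𝒞.filter fun C => i ∈ C).card : ℤ) - if i ∈ N then 1 else 0 with hc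
  have hcC : ∀ C ∈ 𝒞, ∀ i ∈ C, ∀ j ∉ C, c j < c i := by
    intro C hC i hi j hj
    have hiN : i ∉ N := Finset.disjoint_left.1 (h.2.2 C hC) hi
    have hlt : (𝒞.filter fun D => j ∈ D).card < (𝒞.filter fun D => i ∈ D).card := by
      refine Finset.card_lt_card (Finset.ssubset_iff_of_subset ?_ |>.2 ⟨C, ?_, ?_⟩)
      · intro D hD
        rw [Finset.mem_filter] at hD ⊢
        refine ⟨hD.1, ?_⟩
        rcases h.subset_or_subset hC hD.1 with hCD | hDC
        exacts [hCD hi, absurd (hDC hD.2) hj]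
      · simp [hC, hi]
      · simp [hj]
    simp only [hc, hiN, if_false]
    split_ifs <;> omega
  have hcN : ∀ i ∈ Nᶜ, ∀ j ∉ Nᶜ, c j < c i := by
    intro i hi j hj
    rw [Finset.mem_compl] at hi
    rw [Finset.mem_compl, not_not] at hj
    have : (𝒞.filter fun D => j ∈ D) = ∅ := Finset.filter_eq_empty_iff.2 fun D hD hjD =>
      Finset.disjoint_left.1 (h.2.2 D hD) hjD hj
    simp only [hc, hi, hj, this, if_false, if_true, Finset.card_empty]
    omega
  set σ := Tuple.sort c with hσ
  have hσC : ∀ C ∈ 𝒞, ∀ k, σ k ∈ C ↔ n - C.card ≤ (k : ℕ) := fun C hC k =>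
    apply_sort_mem_iff c (hcC C hC) k
  have hσN : ∀ k, σ k ∉ N ↔ N.card ≤ (k : ℕ) := by
    intro k
    have := apply_sort_mem_iff c hcN k
    rw [Finset.mem_compl, Finset.card_compl, Fintype.card_fin] at this
    rw [this]
    have : N.card ≤ n := by simpa using Finset.card_le_univ N
    omega
  set β : Fin n → ℕ := fun i => if i ∈ N then 1 else Spart b ((σ.symm i : ℕ) + 1) with hβ
  have hβσ : ∀ k, β (σ k) = if N.card ≤ (k : ℕ) then Spart b ((k : ℕ) + 1) else 1 := by
    intro k
    by_cases hk : σ k ∈ N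
    · have := mt (hσN k).2 (by simpa using hk)
      simp [hβ, hk, this]
    · have := (hσN k).1 hk
      simp [hβ, hk, this]
  refine ⟨fun i => (β i : ℝ), subset_convexHull ℝ _ ⟨β, ⟨?_, σ, ?_, ?_⟩, rfl⟩, ?_, ?_⟩
  · intro i
    simp only [hβ]
    split_ifs
    exacts [le_rfl, one_le_Spart hb (by omega) (by omega)]
  · intro k l hkl
    have hkl' : (k : ℕ) ≤ l := hkl
    simp only [Function.comp_apply, hβσ]
    split_ifs
    · exact Spart_le (by omega)
    · omega
    · exact one_le_Spart hb (by omega) (by omega)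
    · exact le_rfl
  · intro k
    rw [hβσ]
    split_ifs
    exacts [le_rfl, one_le_Spart hb (by omega) (by omega)]
  · intro C hC
    have hCn : C.card ≤ n := by simpa using Finset.card_le_univ C
    rw [← sum_Spart_top hCn]
    refine Finset.sum_bij' (fun i _ => σ.symm i) (fun k _ => σ k) ?_ ?_ ?_ ?_ ?_
    · intro i hi
      have := (hσC C hC (σ.symm i)).1 (by simpa using hi)
      simpa using this
    · intro k hk
      exact (hσC C hC k).2 (by simpa using hk)
    · simp
    · simp
    · intro i hi
      have : i ∉ N := Finset.disjoint_left.1 (h.2.2 C hC) hi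
      simp [hβ, this]
  · intro i hi
    simp [hβ, hi]

/-- A positive combination of the constraints of a flag exposes its face. -/
lemma IsFlag.setOf_isMax_eq_flagFace (hb : ∀ j < n, 1 ≤ b j) {𝒞 : Finset (Finset (Fin n))}
    {N : Finset (Fin n)} (h : IsFlag 𝒞 N) (u : Finset (Fin n) → ℝ) (w : Fin n → ℝ)
    (hu : ∀ C ∈ 𝒞, 0 < u C) (hw : ∀ i ∈ N, 0 < w i) (l : (Fin n → ℝ) → ℝ)
    (hl : ∀ x, l x = ∑ C ∈ 𝒞, u C * ∑ i ∈ C, x i - ∑ i ∈ N, w i * x i) :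
    {x | x ∈ bpfPolytope n b ∧ ∀ y ∈ bpfPolytope n b, l y ≤ l x} = flagFace b 𝒞 N := by
  have hC : ∀ x ∈ bpfPolytope n b, ∀ C ∈ 𝒞,
      u C * ∑ i ∈ C, x i ≤ u C * topSum n b C.card := fun x hx C hC =>
    mul_le_mul_of_nonneg_left (sum_le_topSum_of_mem_bpfPolytope hx C) (hu C hC).le
  have hN : ∀ x ∈ bpfPolytope n b, ∀ i ∈ N, w i * 1 ≤ w i * x i := fun x hx i hi =>
    mul_le_mul_of_nonneg_left (one_le_of_mem_bpfPolytope hx i) (hw i hi).le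
  have heq : ∀ x ∈ flagFace b 𝒞 N,
      l x = ∑ C ∈ 𝒞, u C * topSum n b C.card - ∑ i ∈ N, w i * 1 := by
    intro x hx
    rw [hl]
    congr 1
    · exact Finset.sum_congr rfl fun C hC => by rw [hx.2.1 C hC]
    · exact Finset.sum_congr rfl fun i hi => by rw [hx.2.2 i hi]
  ext x
  constructor
  · rintro ⟨hx, hmax⟩
    obtain ⟨z, hz⟩ := h.flagFace_nonempty hb
    have hzx := hmax z hz.1
    rw [heq z hz, hl] at hzx
    have h₁ := Finset.sum_le_sum (hC x hx)
    have h₂ := Finset.sum_le_sum (hN x hx)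
    have e₁ := (Finset.sum_eq_sum_iff_of_le (hC x hx)).1 (by linarith)
    have e₂ := (Finset.sum_eq_sum_iff_of_le (hN x hx)).1 (by linarith)
    exact ⟨hx, fun C hC => mul_left_cancel₀ (hu C hC).ne' (e₁ C hC),
      fun i hi => (mul_left_cancel₀ (hw i hi).ne' (e₂ i hi)).symm⟩
  · intro hx
    refine ⟨hx.1, fun y hy => ?_⟩
    rw [heq x hx, hl]
    have h₁ := Finset.sum_le_sum (hC y hy)
    have h₂ := Finset.sum_le_sum (hN y hy)
    linarith

lemma IsFlag.isExposed_flagFace (hb : ∀ j < n, 1 ≤ b j) {𝒞 : Finset (Finset (Fin n))}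
    {N : Finset (Fin n)} (h : IsFlag 𝒞 N) :
    IsExposed ℝ (bpfPolytope n b) (flagFace b 𝒞 N) := by
  intro _
  let L : (Fin n → ℝ) →L[ℝ] ℝ := ∑ C ∈ 𝒞, ∑ i ∈ C, ContinuousLinearMap.proj i -
    ∑ i ∈ N, ContinuousLinearMap.proj i
  refine ⟨L, (h.setOf_isMax_eq_flagFace hb (fun _ => 1) (fun _ => 1) (by simp) (by simp) L
    fun x => ?_).symm⟩
  simp [L]

/-- Layer-cake decomposition of a nonnegative function on a finite set. -/
lemma exists_layerCake (c : Fin n → ℝ) (hc : ∀ i, 0 ≤ c i) :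
    ∃ (𝒞 : Finset (Finset (Fin n))) (u : Finset (Fin n) → ℝ), ∅ ∈ 𝒞 ∧
      IsChain (· ⊆ ·) (𝒞 : Set (Finset (Fin n))) ∧ (∀ C ∈ 𝒞, 0 < u C) ∧
      (∀ C ∈ 𝒞, ∀ i ∈ C, 0 < c i) ∧ ∀ i, c i = ∑ C ∈ 𝒞, if i ∈ C then u C else 0 := by
  classical
  induction hm : (Finset.univ.filter fun i => 0 < c i).card using Nat.strong_induction_on
    generalizing c with
  | _ m ih =>
    set A := Finset.univ.filter fun i => 0 < c i with hA
    have hmemA : ∀ i, i ∈ A ↔ 0 < c i := fun i => by simp [hA]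
    rcases A.eq_empty_or_nonempty with hAe | hAne
    · refine ⟨{∅}, fun _ => 1, by simp, by simp, by simp, by simp, fun i => ?_⟩
      have : ¬ 0 < c i := fun h => by simpa [hAe] using (hmemA i).2 h
      rw [Finset.sum_singleton, if_neg (Finset.notMem_empty i)]
      exact le_antisymm (not_lt.1 this) (hc i)
    · obtain ⟨a, haA, hamin⟩ := Finset.exists_min_image A c hAne
      have hca := (hmemA a).1 haA
      let d : Fin n → ℝ := fun i => c i - if i ∈ A then c a else 0
      have hd : ∀ i, 0 ≤ d i := by
        intro i
        by_cases hi : i ∈ A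
        · simpa [d, hi] using hamin i hi
        · simpa [d, hi] using hc i
      have hdA : ∀ i, 0 < d i → i ∈ A := by
        intro i hi
        by_contra h
        have h' := (hmemA i).not.1 h
        simp only [d, h, if_false, sub_zero] at hi
        exact h' hi
      have hda : ¬ 0 < d a := by simp [d, haA]
      obtain ⟨𝒞, u, h0, hch, hu, hpos, hsum⟩ := ih _ (by
        rw [← hm]
        refine Finset.card_lt_card
          ((Finset.ssubset_iff_of_subset fun i hi => hdA i ?_).2 ⟨a, haA, ?_⟩)
        · simpa using hi
        · simpa using hda) d hd rfl
      have hsub : ∀ C ∈ 𝒞, C ⊆ A := fun C hC i hi => hdA i (hpos C hC i hi)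
      have hA𝒞 : A ∉ 𝒞 := fun h => hda (hpos A h a haA)
      refine ⟨insert A 𝒞, Function.update u A (c a), Finset.mem_insert_of_mem h0, ?_, ?_, ?_,
        fun i => ?_⟩
      · rw [Finset.coe_insert]
        exact hch.insert fun C hC _ => Or.inr (hsub C hC)
      · intro C hC
        rcases Finset.mem_insert.1 hC with rfl | hC
        · simpa using hca
        · rw [Function.update_of_ne (ne_of_mem_of_not_mem hC hA𝒞)]
          exact hu C hC
      · intro C hC i hi
        rcases Finset.mem_insert.1 hC with rfl | hC
        exacts [(hmemA i).1 hi, (hmemA i).1 (hsub C hC hi)]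
      · have h₁ : ∑ C ∈ 𝒞, (if i ∈ C then Function.update u A (c a) C else 0) = d i := by
          rw [hsum]
          refine Finset.sum_congr rfl fun C hC => ?_
          rw [Function.update_of_ne (ne_of_mem_of_not_mem hC hA𝒞)]
        rw [Finset.sum_insert hA𝒞, h₁, Function.update_self]
        simp [d]

lemma exists_isFlag_of_isExposed (hb : ∀ j < n, 1 ≤ b j) {F : Set (Fin n → ℝ)}
    (hF : F.Nonempty) (hexp : IsExposed ℝ (bpfPolytope n b) F) :
    ∃ 𝒞 N, IsFlag 𝒞 N ∧ F = flagFace b 𝒞 N := by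
  classical
  obtain ⟨l, rfl⟩ := hexp hF
  let c : Fin n → ℝ := fun i => l (Pi.single i 1)
  obtain ⟨𝒞, u, h0, hch, hu, hpos, hsum⟩ := exists_layerCake (fun i => max (c i) 0) (by simp)
  have hflag : IsFlag 𝒞 (Finset.univ.filter fun i => c i < 0) := by
    refine ⟨h0, hch, fun C hC => Finset.disjoint_left.2 fun i hi hiN => ?_⟩
    have h₁ := hpos C hC i hi
    have h₂ : c i < 0 := by simpa using hiN
    rw [max_eq_right h₂.le] at h₁
    exact lt_irrefl _ h₁
  refine ⟨𝒞, _, hflag, hflag.setOf_isMax_eq_flagFace hb u (fun i => - c i) hu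
    (fun i hi => by simpa using hi) l fun x => ?_⟩
  have hx : l x = ∑ i, x i * c i := by
    conv_lhs => rw [pi_eq_sum_univ' x]
    simp [c, map_sum]
  have h₁ : ∑ C ∈ 𝒞, u C * ∑ i ∈ C, x i = ∑ i, x i * max (c i) 0 := by
    simp_rw [hsum, Finset.mul_sum]
    rw [Finset.sum_comm]
    refine Finset.sum_congr rfl fun C _ => ?_
    simp [mul_comm]
  rw [h₁, hx, Finset.sum_filter, ← Finset.sum_sub_distrib]
  refine Finset.sum_congr rfl fun i _ => ?_
  split_ifs with hi
  · rw [max_eq_right hi.le]; ring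
  · rw [max_eq_left (not_lt.1 hi)]; ring

end Faces

section Dimension

variable {n : ℕ} {b : ℕ → ℕ} {𝒞 : Finset (Finset (Fin n))} {N : Finset (Fin n)}

lemma IsFlag.exists_top (h : IsFlag 𝒞 N) {𝒮 : Finset (Finset (Fin n))} (h𝒮 : 𝒮 ⊆ 𝒞)
    (hne : 𝒮.Nonempty) : ∃ T ∈ 𝒮, ∀ D ∈ 𝒮, D ⊆ T := by
  obtain ⟨T, hT, hmax⟩ := Finset.exists_max_image 𝒮 Finset.card hne
  refine ⟨T, hT, fun D hD => ?_⟩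
  rcases h.subset_or_subset (h𝒮 hD) (h𝒮 hT) with h | h
  · exact h
  · exact (Finset.eq_of_subset_of_card_le h (hmax D hD)).symm.subset

lemma IsFlag.exists_bot (h : IsFlag 𝒞 N) {𝒮 : Finset (Finset (Fin n))} (h𝒮 : 𝒮 ⊆ 𝒞)
    (hne : 𝒮.Nonempty) : ∃ T ∈ 𝒮, ∀ D ∈ 𝒮, T ⊆ D := by
  obtain ⟨T, hT, hmin⟩ := Finset.exists_min_image 𝒮 Finset.card hne
  refine ⟨T, hT, fun D hD => ?_⟩
  rcases h.subset_or_subset (h𝒮 hD) (h𝒮 hT) with h | h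
  · exact (Finset.eq_of_subset_of_card_le h (hmin D hD)).symm.subset
  · exact h

/-- The functional `x ↦ ∑ i ∈ C, x i`. -/
def coordSum (C : Finset (Fin n)) : (Fin n → ℝ) →ₗ[ℝ] ℝ := ∑ i ∈ C, LinearMap.proj i

@[simp]
lemma coordSum_apply (C : Finset (Fin n)) (x : Fin n → ℝ) : coordSum C x = ∑ i ∈ C, x i := by
  simp [coordSum]

/-- The directions along which all constraints of a flag are constant. -/
def flagDirection (𝒞 : Finset (Finset (Fin n))) (N : Finset (Fin n)) :
    Submodule ℝ (Fin n → ℝ) where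
  carrier := {v | (∀ C ∈ 𝒞, coordSum C v = 0) ∧ ∀ i ∈ N, v i = 0}
  add_mem' {v w} hv hw := ⟨fun C hC => by rw [map_add, hv.1 C hC, hw.1 C hC, add_zero],
    fun i hi => by rw [Pi.add_apply, hv.2 i hi, hw.2 i hi, add_zero]⟩
  zero_mem' := ⟨fun C _ => map_zero _, fun i _ => rfl⟩
  smul_mem' r v hv := ⟨fun C hC => by rw [map_smul, hv.1 C hC, smul_zero],
    fun i hi => by rw [Pi.smul_apply, hv.2 i hi, smul_zero]⟩

lemma vectorSpan_flagFace_le : vectorSpan ℝ (flagFace b 𝒞 N) ≤ flagDirection 𝒞 N := by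
  rw [vectorSpan_def, Submodule.span_le]
  rintro _ ⟨x, hx, y, hy, rfl⟩
  refine ⟨fun C hC => ?_, fun i hi => ?_⟩
  · simp only [vsub_eq_sub, map_sub, coordSum_apply, hx.2.1 C hC, hy.2.1 C hC, sub_self]
  · simp only [vsub_eq_sub, Pi.sub_apply, hx.2.2 i hi, hy.2.2 i hi, sub_self]

lemma single_mem_flagDirection {i : Fin n} (hC : ∀ C ∈ 𝒞, i ∉ C) (hN : i ∉ N) :
    Pi.single i 1 ∈ flagDirection 𝒞 N := by
  refine ⟨fun C h => ?_, fun j hj => ?_⟩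
  · simp [coordSum_apply, Pi.single_apply, hC C h]
  · rw [Pi.single_eq_of_ne (ne_of_mem_of_not_mem hj hN)]

lemma IsFlag.finrank_flagDirection_add_le (h : IsFlag 𝒞 N) :
    Module.finrank ℝ (flagDirection 𝒞 N) + 𝒞.card + N.card ≤ n + 1 := by
  classical
  induction N using Finset.induction_on with
  | empty =>
    induction hm : 𝒞.card using Nat.strong_induction_on generalizing 𝒞 with
    | _ m ih =>
      by_cases h1 : 𝒞 = {∅}
      · have := Submodule.finrank_le (flagDirection 𝒞 ∅)
        rw [Module.finrank_fin_fun] at this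
        rw [h1, Finset.card_singleton] at hm
        rw [Finset.card_empty]
        omega
      · obtain ⟨T, hT, htop⟩ := h.exists_top subset_rfl ⟨∅, h.1⟩
        have hT0 : T ≠ ∅ := by
          rintro rfl
          exact h1 (Finset.eq_singleton_iff_unique_mem.2
            ⟨h.1, fun D hD => Finset.subset_empty.1 (htop D hD)⟩)
        have h0 : ∅ ∈ 𝒞.erase T := Finset.mem_erase.2 ⟨hT0.symm, h.1⟩
        obtain ⟨U, hU, hUtop⟩ := h.exists_top (Finset.erase_subset T 𝒞) ⟨∅, h0⟩
        obtain ⟨hUT, hU𝒞⟩ := Finset.mem_erase.1 hU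
        obtain ⟨a, haT, haU⟩ := Finset.exists_of_ssubset
          (lt_of_le_of_ne (htop U hU𝒞) hUT)
        have hcard := Finset.card_erase_add_one hT
        have hind := ih _ (by omega) (h.mono (Finset.erase_subset T 𝒞) h0 subset_rfl) rfl
        have hlt : flagDirection 𝒞 ∅ < flagDirection (𝒞.erase T) ∅ := by
          refine lt_of_le_of_ne
            (fun v hv => ⟨fun C hC => hv.1 C (Finset.mem_of_mem_erase hC), hv.2⟩) fun heq => ?_
          have hmem : (Pi.single a 1 : Fin n → ℝ) ∈ flagDirection (𝒞.erase T) ∅ :=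
            single_mem_flagDirection (fun C hC haC => haU (hUtop C hC haC)) (by simp)
          rw [← heq] at hmem
          have := hmem.1 T hT
          simp [coordSum_apply, Pi.single_apply, haT] at this
        have := Submodule.finrank_lt_finrank_of_lt hlt
        omega
  | insert i N hi ih =>
    have hind := ih (h.mono subset_rfl h.1 (Finset.subset_insert i N))
    have hlt : flagDirection 𝒞 (insert i N) < flagDirection 𝒞 N := by
      refine lt_of_le_of_ne
        (fun v hv => ⟨hv.1, fun j hj => hv.2 j (Finset.mem_insert_of_mem hj)⟩) fun heq => ?_
      have hmem : (Pi.single i 1 : Fin n → ℝ) ∈ flagDirection 𝒞 N :=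
        single_mem_flagDirection (fun C hC hiC => Finset.disjoint_left.1 (h.2.2 C hC) hiC
          (Finset.mem_insert_self i N)) hi
      rw [← heq] at hmem
      have := hmem.2 i (Finset.mem_insert_self i N)
      simp at this
    have := Submodule.finrank_lt_finrank_of_lt hlt
    rw [Finset.card_insert_of_notMem hi]
    omega

lemma finrank_vectorSpan_lt {G G' : Set (Fin n → ℝ)} (hG : G' ⊆ G) (hne : G'.Nonempty)
    (C : Finset (Fin n)) (r : ℝ) (hr : ∀ x ∈ G', ∑ i ∈ C, x i = r)
    (hx : ∃ x ∈ G, ∑ i ∈ C, x i ≠ r) :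
    Module.finrank ℝ (vectorSpan ℝ G') < Module.finrank ℝ (vectorSpan ℝ G) := by
  obtain ⟨x, hxG, hxr⟩ := hx
  obtain ⟨z, hz⟩ := hne
  refine Submodule.finrank_lt_finrank_of_lt
    (lt_of_le_of_ne (vectorSpan_mono ℝ hG) fun heq => ?_)
  have hker : vectorSpan ℝ G' ≤ LinearMap.ker (coordSum C) := by
    rw [vectorSpan_def, Submodule.span_le]
    rintro _ ⟨y, hy, w, hw, rfl⟩
    simp only [vsub_eq_sub, SetLike.mem_coe, LinearMap.mem_ker, map_sub, coordSum_apply,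
      hr y hy, hr w hw, sub_self]
  have hmem : x -ᵥ z ∈ vectorSpan ℝ G := vsub_mem_vectorSpan ℝ hxG (hG hz)
  rw [← heq] at hmem
  have := hker hmem
  rw [vsub_eq_sub, LinearMap.mem_ker, map_sub, coordSum_apply, coordSum_apply, hr z hz,
    sub_eq_zero] at this
  exact hxr this

/-- The flags that label faces without repetition: if `b 0 = 1`, the bound for the complement
of `i` is only used together with the lower bound for the coordinate `i`. -/
def IsGoodFlag (b : ℕ → ℕ) (𝒞 : Finset (Finset (Fin n))) (N : Finset (Fin n)) : Prop :=
  IsFlag 𝒞 N ∧ (b 0 = 1 → ∀ i, {i}ᶜ ∈ 𝒞 → i ∈ N)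

lemma one_lt_Spart (hb : ∀ j < n, 1 ≤ b j) {k : ℕ} (hk : 0 < k) (hkn : k ≤ n)
    (h : b 0 = 1 → 2 ≤ k) : 1 < Spart b k := by
  have h1 : Spart b 1 = b 0 := by simp [Spart]
  have h0 := hb 0 (by omega)
  by_cases hb0 : b 0 = 1
  · have := Spart_lt hb (i := 1) (j := k) (h hb0) hkn
    omega
  · have := Spart_le (b := b) (i := 1) (j := k) hk
    omega

lemma apply_eq_Spart {x : Fin n → ℝ} {U : Finset (Fin n)} {i : Fin n} (hi : i ∉ U)
    (hU : ∑ j ∈ U, x j = topSum n b U.card)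
    (hiU : ∑ j ∈ insert i U, x j = topSum n b (insert i U).card) :
    x i = Spart b (n - U.card) := by
  rw [Finset.sum_insert hi, Finset.card_insert_of_notMem hi, topSum_succ] at hiU
  linarith

lemma eq_compl_singleton {U : Finset (Fin n)} {i : Fin n} (hi : i ∉ U) (hU : n ≤ U.card + 1) :
    U = {i}ᶜ := by
  refine Finset.eq_of_subset_of_card_le (fun j hj => ?_) ?_
  · simpa using ne_of_mem_of_not_mem hj hi
  · rw [Finset.card_compl, Finset.card_singleton, Fintype.card_fin]
    omega

lemma card_lt_of_notMem {U : Finset (Fin n)} {i : Fin n} (hi : i ∉ U) : U.card < n := by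
  have := Finset.card_lt_univ_of_notMem hi
  rwa [Fintype.card_fin] at this

lemma IsGoodFlag.exists_apply_ne_one (hb : ∀ j < n, 1 ≤ b j) (h : IsGoodFlag b 𝒞 N)
    {i : Fin n} (hi : i ∉ N) : ∃ x ∈ flagFace b 𝒞 N, x i ≠ 1 := by
  classical
  obtain ⟨U, hU, htop⟩ := h.1.exists_top (Finset.filter_subset (fun C => i ∉ C) 𝒞)
    ⟨∅, by simp [h.1.1]⟩
  rw [Finset.mem_filter] at hU
  have hflag : IsFlag (insert (insert i U) 𝒞) N := by
    refine h.1.insert_left (fun D hD => ?_)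
      (Finset.disjoint_insert_left.2 ⟨hi, h.1.2.2 U hU.1⟩)
    by_cases hiD : i ∈ D
    · left
      refine Finset.insert_subset hiD ?_
      rcases h.1.subset_or_subset hU.1 hD with h' | h'
      exacts [h', absurd (h' hiD) hU.2]
    · right
      exact (htop D (Finset.mem_filter.2 ⟨hD, hiD⟩)).trans (Finset.subset_insert i U)
  obtain ⟨x, hx⟩ := hflag.flagFace_nonempty hb
  refine ⟨x, ⟨hx.1, fun C hC => hx.2.1 C (Finset.mem_insert_of_mem hC), hx.2.2⟩, ?_⟩
  rw [apply_eq_Spart hU.2 (hx.2.1 U (Finset.mem_insert_of_mem hU.1))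
    (hx.2.1 _ (Finset.mem_insert_self _ _))]
  have hUn := card_lt_of_notMem hU.2
  have hlt : 1 < Spart b (n - U.card) := by
    refine one_lt_Spart hb (by omega) (by omega) fun hb0 => ?_
    by_contra hcon
    exact hi (h.2 hb0 i (eq_compl_singleton hU.2 (by omega) ▸ hU.1))
  exact_mod_cast hlt.ne'

lemma sum_univ_eq_topSum (hb0 : b 0 = 1) {x : Fin n → ℝ} {i : Fin n}
    (hx : ∑ j ∈ ({i}ᶜ : Finset (Fin n)), x j = topSum n b ({i}ᶜ : Finset (Fin n)).card)
    (hi : x i = 1) : ∑ j, x j = topSum n b (Finset.univ : Finset (Fin n)).card := by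
  have hn := i.pos
  have hcard : ({i}ᶜ : Finset (Fin n)).card = n - 1 := by
    rw [Finset.card_compl, Finset.card_singleton, Fintype.card_fin]
  have h1 : Spart b 1 = 1 := by simp [Spart, hb0]
  rw [hcard] at hx
  rw [Finset.card_univ, Fintype.card_fin, ← Finset.sum_compl_add_sum {i}, hx,
    Finset.sum_singleton, hi]
  obtain ⟨m, rfl⟩ : ∃ m, n = m + 1 := ⟨n - 1, by omega⟩
  rw [topSum_succ, Nat.add_sub_cancel, Nat.add_sub_cancel_left, h1, Nat.cast_one]

lemma IsGoodFlag.le_finrank_vectorSpan_add (hb : ∀ j < n, 1 ≤ b j) (h : IsGoodFlag b 𝒞 N) :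
    n + 1 ≤ Module.finrank ℝ (vectorSpan ℝ (flagFace b 𝒞 N)) + 𝒞.card + N.card := by
  classical
  induction hm : n + 1 - (𝒞.card + N.card) using Nat.strong_induction_on
    generalizing 𝒞 N with
  | _ m ih =>
    by_cases hlt : n + 1 ≤ 𝒞.card + N.card
    · omega
    -- It suffices to find a smaller face whose label has one more constraint.
    have step : ∀ 𝒞' N', IsGoodFlag b 𝒞' N' → 𝒞'.card + N'.card = 𝒞.card + N.card + 1 →
        flagFace b 𝒞' N' ⊆ flagFace b 𝒞 N →
        (∃ C r, (∀ x ∈ flagFace b 𝒞' N', ∑ i ∈ C, x i = r) ∧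
          ∃ x ∈ flagFace b 𝒞 N, ∑ i ∈ C, x i ≠ r) →
        n + 1 ≤ Module.finrank ℝ (vectorSpan ℝ (flagFace b 𝒞 N)) + 𝒞.card + N.card := by
      rintro 𝒞' N' hgood hcard hsub ⟨C, r, hr, hx⟩
      have h₁ := ih _ (by omega) hgood rfl
      have h₂ := finrank_vectorSpan_lt hsub (hgood.1.flagFace_nonempty hb) C r hr hx
      omega
    obtain ⟨T, hT, htop⟩ := h.1.exists_top subset_rfl ⟨∅, h.1.1⟩
    by_cases hZ : ∃ i, i ∉ T ∧ i ∉ N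
    · obtain ⟨i, hiT, hiN⟩ := hZ
      refine step 𝒞 (insert i N) ⟨h.1.insert_right fun C hC hiC => hiT (htop C hC hiC),
        fun hb0 j hj => Finset.mem_insert_of_mem (h.2 hb0 j hj)⟩ ?_ ?_ ⟨{i}, 1, ?_, ?_⟩
      · rw [Finset.card_insert_of_notMem hiN]
        omega
      · exact fun x hx => ⟨hx.1, hx.2.1, fun j hj => hx.2.2 j (Finset.mem_insert_of_mem hj)⟩
      · intro x hx
        simpa using hx.2.2 i (Finset.mem_insert_self i N)
      · simpa using h.exists_apply_ne_one hb hiN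
    push Not at hZ
    by_cases hT1 : b 0 = 1 ∧ T = Finset.univ
    · obtain ⟨hb0, rfl⟩ := hT1
      have hN : N = ∅ := Finset.eq_empty_of_forall_notMem fun j =>
        Finset.disjoint_left.1 (h.1.2.2 _ hT) (Finset.mem_univ j)
      subst hN
      have hne : (∅ : Finset (Fin n)) ≠ Finset.univ := by
        intro he
        have hn : n = 0 := by simpa using (congrArg Finset.card he).symm
        have := Finset.card_pos.2 ⟨_, hT⟩
        omega
      have h0 : ∅ ∈ 𝒞.erase Finset.univ := Finset.mem_erase.2 ⟨hne, h.1.1⟩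
      obtain ⟨U, hU, hUtop⟩ := h.1.exists_top (Finset.erase_subset Finset.univ 𝒞) ⟨∅, h0⟩
      obtain ⟨hU1, hU𝒞⟩ := Finset.mem_erase.1 hU
      obtain ⟨i, hi⟩ : ∃ i, i ∉ U := by
        by_contra! hcon
        exact hU1 (Finset.eq_univ_iff_forall.2 hcon)
      have hi𝒞 : ({i}ᶜ : Finset (Fin n)) ∉ 𝒞 := fun hmem => by simpa using h.2 hb0 i hmem
      have hUi : ∀ D ∈ 𝒞.erase Finset.univ, D ⊆ {i}ᶜ := fun D hD j hj => by
        simpa using ne_of_mem_of_not_mem (hUtop D hD hj) hi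
      have hcard := Finset.card_erase_add_one hT
      refine step (insert {i}ᶜ (𝒞.erase Finset.univ)) {i} ⟨?_, ?_⟩ ?_ ?_ ⟨{i}, 1, ?_, ?_⟩
      · refine IsFlag.insert_left ⟨h0, (h.1.mono (Finset.erase_subset _ 𝒞) h0 subset_rfl).2.1,
          fun C hC => ?_⟩ (fun D hD => Or.inr (hUi D hD)) ?_
        · exact Finset.disjoint_singleton_right.2 fun hiC => by simpa using hUi C hC hiC
        · simp
      · intro _ j hj
        rcases Finset.mem_insert.1 hj with hj | hj
        · simpa using hj
        · simpa using h.2 hb0 j (Finset.mem_of_mem_erase hj)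
      · rw [Finset.card_insert_of_notMem fun hmem => hi𝒞 (Finset.mem_of_mem_erase hmem),
          Finset.card_singleton, Finset.card_empty]
        omega
      · refine fun x hx => ⟨hx.1, fun C hC => ?_, by simp⟩
        by_cases hC1 : C = Finset.univ
        · subst hC1
          exact sum_univ_eq_topSum hb0 (hx.2.1 _ (Finset.mem_insert_self _ _))
            (hx.2.2 i (Finset.mem_singleton_self i))
        · exact hx.2.1 C (Finset.mem_insert_of_mem (Finset.mem_erase.2 ⟨hC1, hC⟩))
      · intro x hx
        simpa using hx.2.2 i (Finset.mem_singleton_self i)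
      · simpa using h.exists_apply_ne_one hb (i := i) (by simp)
    · have hTN : n ≤ T.card + N.card := by
        have hu : T ∪ N = Finset.univ := by
          refine Finset.eq_univ_iff_forall.2 fun i => ?_
          by_cases hi : i ∈ T
          · exact Finset.mem_union_left _ hi
          · exact Finset.mem_union_right _ (hZ i hi)
        have := Finset.card_union_le T N
        rwa [hu, Finset.card_univ, Fintype.card_fin] at this
      obtain ⟨j, hjT, hj⟩ : ∃ j ≤ T.card, ∀ D ∈ 𝒞, D.card ≠ j := by
        by_contra! hcon
        have hsub : Finset.range (T.card + 1) ⊆ 𝒞.image Finset.card := fun j hj => by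
          obtain ⟨D, hD, hDj⟩ := hcon j (by rw [Finset.mem_range] at hj; omega)
          exact Finset.mem_image.2 ⟨D, hD, hDj⟩
        have := (Finset.card_le_card hsub).trans Finset.card_image_le
        rw [Finset.card_range] at this
        omega
      obtain ⟨L, hL, hLtop⟩ := h.1.exists_top (Finset.filter_subset (fun D => D.card < j) 𝒞)
        ⟨∅, Finset.mem_filter.2 ⟨h.1.1, by
          have := hj ∅ h.1.1
          rw [Finset.card_empty] at this ⊢
          omega⟩⟩
      obtain ⟨H, hH, hHbot⟩ := h.1.exists_bot (Finset.filter_subset (fun D => j < D.card) 𝒞)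
        ⟨T, Finset.mem_filter.2 ⟨hT, lt_of_le_of_ne hjT (hj T hT).symm⟩⟩
      rw [Finset.mem_filter] at hL hH
      have hLH : L ⊆ H := by
        rcases h.1.subset_or_subset hL.1 hH.1 with h' | h'
        · exact h'
        · have := Finset.card_le_card h'
          omega
      obtain ⟨C, hLC, hCH, hCj⟩ := Finset.exists_subsuperset_card_eq hLH hL.2.le hH.2.le
      have hsplit : ∀ D ∈ 𝒞, D ⊆ L ∨ H ⊆ D := fun D hD => by
        rcases lt_or_gt_of_ne (hj D hD) with h' | h'
        · exact Or.inl (hLtop D (Finset.mem_filter.2 ⟨hD, h'⟩))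
        · exact Or.inr (hHbot D (Finset.mem_filter.2 ⟨hD, h'⟩))
      have hC𝒞 : C ∉ 𝒞 := fun hC => hj C hC hCj
      obtain ⟨a, haC, haL⟩ := Finset.exists_mem_notMem_of_card_lt_card (hCj.symm ▸ hL.2)
      obtain ⟨e, heH, heC⟩ := Finset.exists_mem_notMem_of_card_lt_card (hCj.symm ▸ hH.2)
      have hNH := h.1.2.2 H hH.1
      refine step (insert C 𝒞) N ⟨h.1.insert_left (fun D hD => ?_) (hNH.mono_left hCH), ?_⟩
        ?_ ?_ ⟨C, topSum n b C.card, ?_, ?_⟩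
      · exact (hsplit D hD).symm.imp hCH.trans fun h' => h'.trans hLC
      · intro hb0 i hi
        rcases Finset.mem_insert.1 hi with hi | hi
        · exfalso
          have h₁ : C.card = n - 1 := by
            rw [← hi, Finset.card_compl, Finset.card_singleton, Fintype.card_fin]
          have h₂ := Finset.card_le_card (htop H hH.1)
          refine hT1 ⟨hb0, Finset.eq_univ_of_card T ?_⟩
          have h₃ := Finset.card_le_univ T
          rw [Fintype.card_fin] at h₃ ⊢
          omega
        · exact h.2 hb0 i hi
      · rw [Finset.card_insert_of_notMem hC𝒞]
        omega
      · exact fun x hx => ⟨hx.1, fun D hD => hx.2.1 D (Finset.mem_insert_of_mem hD), hx.2.2⟩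
      · exact fun x hx => hx.2.1 C (Finset.mem_insert_self _ _)
      · have hC'H : insert e (C.erase a) ⊆ H :=
          Finset.insert_subset heH ((Finset.erase_subset a C).trans hCH)
        have hflag : IsFlag (insert (insert e (C.erase a)) 𝒞) N := by
          refine h.1.insert_left (fun D hD => ?_) (hNH.mono_left hC'H)
          refine (hsplit D hD).symm.imp hC'H.trans fun h' => h'.trans fun k hk => ?_
          exact Finset.mem_insert_of_mem
            (Finset.mem_erase.2 ⟨ne_of_mem_of_not_mem hk haL, hLC hk⟩)
        obtain ⟨x, hx⟩ := hflag.flagFace_nonempty hb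
        refine ⟨x, ⟨hx.1, fun D hD => hx.2.1 D (Finset.mem_insert_of_mem hD), hx.2.2⟩,
          fun htight => ?_⟩
        rcases subset_or_subset_of_tight hb hx.1 htight
          (hx.2.1 _ (Finset.mem_insert_self _ _)) with h' | h'
        · rcases Finset.mem_insert.1 (h' haC) with hae | hae
          · exact heC (hae ▸ haC)
          · simp at hae
        · exact heC (h' (Finset.mem_insert_self _ _))

lemma IsGoodFlag.finrank_vectorSpan_add (hb : ∀ j < n, 1 ≤ b j) (h : IsGoodFlag b 𝒞 N) :
    Module.finrank ℝ (vectorSpan ℝ (flagFace b 𝒞 N)) + 𝒞.card + N.card = n + 1 := by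
  have h₁ := h.le_finrank_vectorSpan_add hb
  have h₂ := h.1.finrank_flagDirection_add_le
  have h₃ := Submodule.finrank_mono (vectorSpan_flagFace_le (b := b) (𝒞 := 𝒞) (N := N))
  omega

lemma IsGoodFlag.le_of_flagFace_eq (hb : ∀ j < n, 1 ≤ b j)
    {𝒞' : Finset (Finset (Fin n))} {N' : Finset (Fin n)} (h : IsGoodFlag b 𝒞 N)
    (h' : IsGoodFlag b 𝒞' N') (heq : flagFace b 𝒞 N = flagFace b 𝒞' N') :
    N' ⊆ N ∧ (N = N' → 𝒞' ⊆ 𝒞) := by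
  classical
  refine ⟨fun i hi => ?_, ?_⟩
  · by_contra hiN
    obtain ⟨x, hx, hxi⟩ := h.exists_apply_ne_one hb hiN
    rw [heq] at hx
    exact hxi (hx.2.2 i hi)
  · rintro rfl
    obtain ⟨x, hx⟩ := h.1.flagFace_nonempty hb
    have hx' := hx
    rw [heq] at hx'
    have htight : ∀ C ∈ 𝒞 ∪ 𝒞', ∑ i ∈ C, x i = topSum n b C.card := fun C hC =>
      (Finset.mem_union.1 hC).elim (hx.2.1 C) (hx'.2.1 C)
    have hgood : IsGoodFlag b (𝒞 ∪ 𝒞') N := by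
      refine ⟨⟨Finset.mem_union_left _ h.1.1, fun C hC D hD _ => ?_, fun C hC => ?_⟩,
        fun hb0 i hi => ?_⟩
      · exact subset_or_subset_of_tight hb hx.1 (htight C hC) (htight D hD)
      · exact (Finset.mem_union.1 hC).elim (h.1.2.2 C) (h'.1.2.2 C)
      · exact (Finset.mem_union.1 hi).elim (h.2 hb0 i) (h'.2 hb0 i)
    have hface : flagFace b (𝒞 ∪ 𝒞') N = flagFace b 𝒞 N := by
      ext y
      refine ⟨fun hy => ⟨hy.1, fun C hC => hy.2.1 C (Finset.mem_union_left _ hC), hy.2.2⟩,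
        fun hy => ⟨hy.1, fun C hC => ?_, hy.2.2⟩⟩
      have hy' := hy
      rw [heq] at hy'
      exact (Finset.mem_union.1 hC).elim (hy.2.1 C) (hy'.2.1 C)
    have h₁ := hgood.finrank_vectorSpan_add hb
    have h₂ := h.finrank_vectorSpan_add hb
    rw [hface] at h₁
    have h₃ : 𝒞 = 𝒞 ∪ 𝒞' :=
      Finset.eq_of_subset_of_card_le Finset.subset_union_left (by omega)
    rw [h₃]
    exact Finset.subset_union_right

lemma IsGoodFlag.eq_of_flagFace_eq (hb : ∀ j < n, 1 ≤ b j)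
    {𝒞' : Finset (Finset (Fin n))} {N' : Finset (Fin n)} (h : IsGoodFlag b 𝒞 N)
    (h' : IsGoodFlag b 𝒞' N') (heq : flagFace b 𝒞 N = flagFace b 𝒞' N') :
    𝒞 = 𝒞' ∧ N = N' := by
  have h₁ := h.le_of_flagFace_eq hb h' heq
  have h₂ := h'.le_of_flagFace_eq hb h heq.symm
  have hN := h₂.1.antisymm h₁.1
  exact ⟨(h₂.2 hN.symm).antisymm (h₁.2 hN), hN⟩

lemma exists_isGoodFlag_of_isExposed (hb : ∀ j < n, 1 ≤ b j) {F : Set (Fin n → ℝ)}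
    (hF : F.Nonempty) (hexp : IsExposed ℝ (bpfPolytope n b) F) :
    ∃ 𝒞 N, IsGoodFlag b 𝒞 N ∧ F = flagFace b 𝒞 N := by
  classical
  obtain ⟨𝒞, N, h, rfl⟩ := exists_isFlag_of_isExposed hb hF hexp
  by_cases hgood : IsGoodFlag b 𝒞 N
  · exact ⟨𝒞, N, hgood, rfl⟩
  obtain ⟨hb0, i, hi𝒞, hiN⟩ : b 0 = 1 ∧ ∃ i, {i}ᶜ ∈ 𝒞 ∧ i ∉ N := by
    simpa [IsGoodFlag, h] using hgood
  have hN : N = ∅ := by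
    refine Finset.eq_empty_of_forall_notMem fun j hj => ?_
    by_cases hji : j = i
    · exact hiN (hji ▸ hj)
    · exact Finset.disjoint_left.1 (h.2.2 _ hi𝒞) (by simpa using hji) hj
  subst hN
  have hn : (∅ : Finset (Fin n)) ≠ Finset.univ := fun he => by
    have := Finset.mem_univ i
    simp [← he] at this
  have hi1 : ({i}ᶜ : Finset (Fin n)) ≠ Finset.univ := fun he => by
    have := Finset.mem_univ i
    simp [← he] at this
  have hi𝒞' : {i}ᶜ ∈ 𝒞.erase Finset.univ := Finset.mem_erase.2 ⟨hi1, hi𝒞⟩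
  have hsub : ∀ D ∈ 𝒞.erase Finset.univ, D ⊆ {i}ᶜ := by
    intro D hD
    obtain ⟨hD1, hD⟩ := Finset.mem_erase.1 hD
    rcases h.subset_or_subset hD hi𝒞 with h' | h'
    · exact h'
    · intro j hj
      rw [Finset.mem_compl, Finset.mem_singleton]
      rintro rfl
      refine hD1 (Finset.eq_univ_iff_forall.2 fun k => ?_)
      by_cases hk : k = j
      · exact hk ▸ hj
      · exact h' (by simpa using hk)
  refine ⟨𝒞.erase Finset.univ, {i}, ⟨⟨Finset.mem_erase.2 ⟨hn, h.1⟩,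
    h.2.1.mono (by exact_mod_cast Finset.erase_subset _ 𝒞), fun C hC => ?_⟩,
    fun _ j hj => ?_⟩, ?_⟩
  · exact Finset.disjoint_singleton_right.2 fun hiC => by simpa using hsub C hC hiC
  · simpa [eq_comm] using hsub _ hj
  · ext x
    constructor
    · intro hx
      refine ⟨hx.1, fun C hC => hx.2.1 C (Finset.mem_of_mem_erase hC), fun j hj => ?_⟩
      obtain rfl := Finset.mem_singleton.1 hj
      have h₁ := sum_le_topSum_of_mem_bpfPolytope hx.1 (insert j {j}ᶜ)
      have h₂ := hx.2.1 _ hi𝒞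
      have hj' : j ∉ ({j}ᶜ : Finset (Fin n)) := by simp
      rw [Finset.sum_insert hj', Finset.card_insert_of_notMem hj', topSum_succ, h₂,
        Finset.card_compl, Finset.card_singleton, Fintype.card_fin,
        Nat.sub_sub_self j.pos] at h₁
      have h₃ : (Spart b 1 : ℝ) = 1 := by simp [Spart, hb0]
      have := one_le_of_mem_bpfPolytope hx.1 j
      linarith
    · intro hx
      refine ⟨hx.1, fun C hC => ?_, by simp⟩
      by_cases hC1 : C = Finset.univ
      · subst hC1
        exact sum_univ_eq_topSum hb0 (hx.2.1 _ hi𝒞')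
          (hx.2.2 i (Finset.mem_singleton_self i))
      · exact hx.2.1 C (Finset.mem_erase.2 ⟨hC1, hC⟩)

end Dimension

section Eulerian

lemma sum_powerset_eq_add_sum_max {α M : Type*} [LinearOrder α] [AddCommMonoid M]
    (A : Finset α) (f : Finset α → M) :
    ∑ T ∈ A.powerset, f T =
      f ∅ + ∑ a ∈ A, ∑ T ∈ (A.filter (· < a)).powerset, f (insert a T) := by
  induction A using Finset.induction_on_max with
  | empty => simp
  | insert m A hm ih =>
    have hmA : m ∉ A := fun h => lt_irrefl _ (hm m h)
    rw [Finset.sum_powerset_insert hmA, ih, Finset.sum_insert hmA, add_assoc]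
    congr 1
    rw [add_comm]
    congr 1
    · rw [Finset.filter_insert, if_neg (lt_irrefl m), Finset.filter_true_of_mem hm]
    · refine Finset.sum_congr rfl fun a ha => ?_
      rw [Finset.filter_insert, if_neg (hm a ha).not_gt]

/-- The polynomials counting ordered set partitions of a `k`-element set by `k` minus the
number of blocks, evaluated at `X - 1`. -/
noncomputable def ordPartitionPoly : ℕ → ℤ[X]
  | 0 => 1
  | k + 1 => ∑ j : Fin (k + 1),
      ((k + 1).choose j : ℤ[X]) * ((X - 1) ^ (k - (j : ℕ)) * ordPartitionPoly j)

lemma ordPartitionPoly_card {α : Type*} [DecidableEq α] {U : Finset α} (hU : U.Nonempty) :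
    ordPartitionPoly U.card =
      ∑ C ∈ U.ssubsets, (X - 1) ^ (U.card - C.card - 1) * ordPartitionPoly C.card := by
  obtain ⟨k, hk⟩ : ∃ k, U.card = k + 1 := ⟨U.card - 1, by have := hU.card_pos; omega⟩
  let g : ℕ → ℤ[X] := fun j =>
    if j < k + 1 then (X - 1) ^ (k + 1 - j - 1) * ordPartitionPoly j else 0
  have h₁ : ∑ C ∈ U.ssubsets, (X - 1) ^ (U.card - C.card - 1) * ordPartitionPoly C.card =
      ∑ C ∈ U.powerset, g C.card := by
    refine Finset.sum_subset_zero_on_sdiff (fun C hC => ?_) (fun C hC => ?_) fun C hC => ?_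
    · exact Finset.mem_powerset.2 (Finset.mem_ssubsets.1 hC).subset
    · rw [Finset.mem_sdiff, Finset.mem_powerset, Finset.mem_ssubsets] at hC
      have hCU : C = U := by
        by_contra hne
        exact hC.2 (lt_of_le_of_ne hC.1 hne)
      simp [g, hCU, hk]
    · have := Finset.card_lt_card (Finset.mem_ssubsets.1 hC)
      simp only [g, hk]
      rw [if_pos (by omega)]
  rw [h₁, Finset.sum_powerset_apply_card, hk, Finset.sum_range_succ, ordPartitionPoly,
    Finset.sum_range]
  simp only [g, lt_irrefl, if_false, smul_zero, add_zero]
  refine Finset.sum_congr rfl fun j _ => ?_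
  rw [if_pos j.2, nsmul_eq_mul]
  congr 3
  omega

lemma eq_ordPartitionPoly {α : Type*} [DecidableEq α] (P : Finset α → ℤ[X]) (h0 : P ∅ = 1)
    (hP : ∀ U : Finset α, U.Nonempty →
      P U = ∑ C ∈ U.ssubsets, (X - 1) ^ (U.card - C.card - 1) * P C) (U : Finset α) :
    P U = ordPartitionPoly U.card := by
  induction U using Finset.strongInduction with
  | H U ih =>
    rcases U.eq_empty_or_nonempty with rfl | hU
    · rw [h0, Finset.card_empty, ordPartitionPoly]
    · rw [hP U hU, ordPartitionPoly_card hU]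
      exact Finset.sum_congr rfl fun C hC => by rw [ih C (Finset.mem_ssubsets.1 hC)]

/-- The number of descents of a word. -/
noncomputable def wordDescents {α : Type*} [LinearOrder α] {k : ℕ} (w : Fin k → α) : ℕ :=
  Nat.card {i : Fin k // ∃ h : (i : ℕ) + 1 < k, w ⟨(i : ℕ) + 1, h⟩ < w i}

lemma wordDescents_cons {α : Type*} [LinearOrder α] {k : ℕ} (a : α) (w : Fin (k + 1) → α) :
    wordDescents (Fin.cons a w : Fin (k + 2) → α) =
      (if w 0 < a then 1 else 0) + wordDescents w := by
  classical
  unfold wordDescents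
  simp only [Nat.card_eq_fintype_card, Fintype.card_subtype, Finset.card_filter]
  rw [Fin.sum_univ_succ]
  congr 1
  · have : (⟨0 + 1, by omega⟩ : Fin (k + 2)) = Fin.succ 0 := rfl
    simp [this]
  · refine Finset.sum_congr rfl fun i _ => ?_
    congr 1
    refine propext ⟨fun ⟨h, h'⟩ => ?_, fun ⟨h, h'⟩ => ?_⟩
    · exact ⟨by simpa using h, h'⟩
    · exact ⟨by simpa using h, h'⟩

lemma wordDescents_of_le_one {α : Type*} [LinearOrder α] {k : ℕ} (hk : k ≤ 1)
    (w : Fin k → α) : wordDescents w = 0 := by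
  unfold wordDescents
  rw [Nat.card_eq_zero]
  exact Or.inl ⟨fun ⟨i, h, _⟩ => by omega⟩

/-- The word `w` lists each element of `S` exactly once. -/
def IsListing {α : Type*} [DecidableEq α] {k : ℕ} (S : Finset α) (w : Fin k → α) : Prop :=
  Function.Injective w ∧ Finset.univ.image w = S

lemma isListing_cons {α : Type*} [DecidableEq α] {k : ℕ} (S : Finset α) (a : α)
    (w : Fin k → α) :
    IsListing S (Fin.cons a w : Fin (k + 1) → α) ↔ a ∈ S ∧ IsListing (S.erase a) w := by
  have himage : Finset.univ.image (Fin.cons a w : Fin (k + 1) → α) =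
      insert a (Finset.univ.image w) := by
    ext x
    simp [Fin.exists_fin_succ, eq_comm]
  have hrange : a ∉ Set.range w ↔ a ∉ Finset.univ.image w := by simp
  rw [IsListing, IsListing, Fin.cons_injective_iff, himage, hrange]
  constructor
  · rintro ⟨⟨ha, hw⟩, rfl⟩
    exact ⟨Finset.mem_insert_self _ _, hw, (Finset.erase_insert ha).symm⟩
  · rintro ⟨ha, hw, hS⟩
    rw [hS]
    exact ⟨⟨Finset.notMem_erase a S, hw⟩, Finset.insert_erase ha⟩

lemma sum_fin_succ_fun {α M : Type*} [Fintype α] [AddCommMonoid M] {k : ℕ}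
    (f : (Fin (k + 1) → α) → M) :
    ∑ w, f w = ∑ a, ∑ w : Fin k → α, f (Fin.cons a w) := by
  rw [← (Fin.consEquiv fun _ => α).sum_comp, Fintype.sum_prod_type]
  rfl

open Classical in
/-- The descent polynomial of the words listing `S`. -/
noncomputable def listingPoly {α : Type*} [LinearOrder α] [Fintype α] (k : ℕ) (S : Finset α) :
    ℤ[X] :=
  ∑ w : Fin k → α, if IsListing S w then X ^ wordDescents w else 0

open Classical in
/-- The descent polynomial of the words listing `S` that start with `a`. -/
noncomputable def headPoly {α : Type*} [LinearOrder α] [Fintype α] (k : ℕ) (S : Finset α)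
    (a : α) : ℤ[X] :=
  ∑ w : Fin k → α, if IsListing S (Fin.cons a w : Fin (k + 1) → α) then
    X ^ wordDescents (Fin.cons a w : Fin (k + 1) → α) else 0

variable {α : Type*} [LinearOrder α] [Fintype α]

lemma listingPoly_zero : listingPoly 0 (∅ : Finset α) = 1 := by
  have h : IsListing (∅ : Finset α) (default : Fin 0 → α) :=
    ⟨Function.injective_of_subsingleton _, by simp⟩
  rw [listingPoly, Fintype.sum_unique, if_pos h, wordDescents_of_le_one zero_le_one, pow_zero]

lemma headPoly_eq_zero {k : ℕ} {S : Finset α} {a : α} (ha : a ∉ S) : headPoly k S a = 0 :=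
  Finset.sum_eq_zero fun w _ => if_neg fun h => ha ((isListing_cons S a w).1 h).1

lemma listingPoly_succ (k : ℕ) (S : Finset α) :
    listingPoly (k + 1) S = ∑ a ∈ S, headPoly k S a := by
  rw [listingPoly, sum_fin_succ_fun]
  exact (Finset.sum_subset (Finset.subset_univ S) fun a _ ha => headPoly_eq_zero ha).symm

lemma headPoly_zero (a : α) : headPoly 0 {a} a = 1 := by
  have h : IsListing {a} (Fin.cons a default : Fin 1 → α) :=
    (isListing_cons _ _ _).2 ⟨Finset.mem_singleton_self a,
      Function.injective_of_subsingleton _, by simp⟩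
  rw [headPoly, Fintype.sum_unique, if_pos h, wordDescents_of_le_one le_rfl, pow_zero]

lemma headPoly_succ {k : ℕ} {S : Finset α} {a : α} (ha : a ∈ S) :
    headPoly (k + 1) S a =
      ∑ c ∈ S.erase a, (if c < a then X else 1) * headPoly k (S.erase a) c := by
  have h : headPoly (k + 1) S a =
      ∑ c, (if c < a then X else 1) * headPoly k (S.erase a) c := by
    rw [headPoly, sum_fin_succ_fun]
    refine Finset.sum_congr rfl fun c _ => ?_
    rw [headPoly, Finset.mul_sum]
    refine Finset.sum_congr rfl fun w _ => ?_
    rw [wordDescents_cons, Fin.cons_zero, isListing_cons S a]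
    by_cases h : IsListing (S.erase a) (Fin.cons c w : Fin (k + 1) → α)
    · rw [if_pos ⟨ha, h⟩, if_pos h, pow_add]
      split_ifs <;> simp
    · rw [if_neg fun h' => h h'.2, if_neg h, mul_zero]
  rw [h]
  exact (Finset.sum_subset (Finset.subset_univ _) fun c _ hc => by
    rw [headPoly_eq_zero hc, mul_zero]).symm

lemma headPoly_eq_sum {k : ℕ} {S : Finset α} {a : α} (hS : S.card = k + 1) (ha : a ∈ S) :
    headPoly k S a = ∑ T ∈ (S.filter (· < a)).powerset,
      (X - 1) ^ T.card * listingPoly (S \ insert a T).card (S \ insert a T) := by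
  induction k generalizing S a with
  | zero =>
    obtain ⟨c, rfl⟩ := Finset.card_eq_one.1 hS
    obtain rfl := Finset.mem_singleton.1 ha
    simp [headPoly_zero, Finset.filter_singleton, listingPoly_zero]
  | succ k ih =>
    have hS' : (S.erase a).card = k + 1 := by rw [Finset.card_erase_of_mem ha]; omega
    rw [headPoly_succ ha, sum_powerset_eq_add_sum_max]
    have hsplit : ∀ c ∈ S.erase a,
        (if c < a then X else 1) * headPoly k (S.erase a) c = headPoly k (S.erase a) c +
          if c < a then (X - 1) * headPoly k (S.erase a) c else 0 := by
      intro c _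
      split_ifs <;> ring
    rw [Finset.sum_congr rfl hsplit, Finset.sum_add_distrib, ← Finset.sum_filter]
    have hfilter : (S.erase a).filter (· < a) = S.filter (· < a) := by
      ext c
      simp only [Finset.mem_filter, Finset.mem_erase]
      exact ⟨fun h => ⟨h.1.2, h.2⟩, fun h => ⟨⟨h.2.ne, h.1⟩, h.2⟩⟩
    congr 1
    · simp [Finset.sdiff_singleton_eq_erase, hS', listingPoly_succ]
    · rw [hfilter]
      refine Finset.sum_congr rfl fun c hc => ?_
      obtain ⟨hcS, hca⟩ := Finset.mem_filter.1 hc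
      have hfilter' : (S.erase a).filter (· < c) = (S.filter (· < a)).filter (· < c) := by
        ext d
        simp only [Finset.mem_filter, Finset.mem_erase]
        exact ⟨fun h => ⟨⟨h.1.2, h.2.trans hca⟩, h.2⟩,
          fun h => ⟨⟨h.1.2.ne, h.1.1⟩, h.2⟩⟩
      rw [ih hS' (Finset.mem_erase.2 ⟨hca.ne, hcS⟩), hfilter', Finset.mul_sum]
      refine Finset.sum_congr rfl fun T hT => ?_
      have hcT : c ∉ T := fun h => by simpa using Finset.mem_powerset.1 hT h
      have hsdiff : S.erase a \ insert c T = S \ insert a (insert c T) := by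
        ext d
        simp only [Finset.mem_sdiff, Finset.mem_erase, Finset.mem_insert]
        tauto
      rw [hsdiff, Finset.card_insert_of_notMem hcT, pow_succ']
      ring

lemma listingPoly_eq_sum_ssubsets {U : Finset α} (hU : U.Nonempty) :
    listingPoly U.card U =
      ∑ C ∈ U.ssubsets, (X - 1) ^ (U.card - C.card - 1) * listingPoly C.card C := by
  obtain ⟨k, hk⟩ : ∃ k, U.card = k + 1 := ⟨U.card - 1, by have := hU.card_pos; omega⟩
  let f : Finset α → ℤ[X] := fun T =>
    if T = ∅ then 0 else (X - 1) ^ (T.card - 1) * listingPoly (U \ T).card (U \ T)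
  have hf := sum_powerset_eq_add_sum_max U f
  have h₁ : listingPoly U.card U = ∑ T ∈ U.powerset, f T := by
    rw [hf, hk, listingPoly_succ]
    simp only [f, if_true, zero_add]
    refine Finset.sum_congr rfl fun a ha => ?_
    rw [headPoly_eq_sum hk ha]
    refine Finset.sum_congr rfl fun T hT => ?_
    have haT : a ∉ T := fun h => by simpa using Finset.mem_powerset.1 hT h
    rw [if_neg (Finset.insert_ne_empty a T), Finset.card_insert_of_notMem haT,
      Nat.add_sub_cancel]
  rw [h₁, ← Finset.sum_subset (s₁ := U.powerset.erase ∅) (Finset.erase_subset _ _)]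
  · refine Finset.sum_bij' (fun T _ => U \ T) (fun C _ => U \ C) ?_ ?_ ?_ ?_ ?_
    · intro T hT
      simp only [Finset.mem_erase, Finset.mem_powerset] at hT
      exact Finset.mem_ssubsets.2
        (Finset.sdiff_ssubset hT.2 (Finset.nonempty_iff_ne_empty.2 hT.1))
    · intro C hC
      have hC := Finset.mem_ssubsets.1 hC
      simp only [Finset.mem_erase, Finset.mem_powerset]
      exact ⟨(Finset.sdiff_nonempty.2 hC.2).ne_empty, Finset.sdiff_subset⟩
    · intro T hT
      exact Finset.sdiff_sdiff_eq_self (Finset.mem_powerset.1 (Finset.mem_of_mem_erase hT))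
    · intro C hC
      exact Finset.sdiff_sdiff_eq_self (Finset.mem_ssubsets.1 hC).subset
    · intro T hT
      simp only [Finset.mem_erase, Finset.mem_powerset] at hT
      have := Finset.card_sdiff_of_subset hT.2
      have := Finset.card_le_card hT.2
      simp only [f, if_neg hT.1]
      congr 2
      omega
  · intro T hT hT'
    have : T = ∅ := by
      by_contra hne
      exact hT' (Finset.mem_erase.2 ⟨hne, hT⟩)
    simp [f, this]

lemma eulerianPoly_eq_ordPartitionPoly (k : ℕ) : eulerianPoly k = ordPartitionPoly k := by
  classical
  have h := eq_ordPartitionPoly (fun S : Finset (Fin k) => listingPoly S.card S)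
    listingPoly_zero (fun U hU => listingPoly_eq_sum_ssubsets hU) Finset.univ
  simp only [Finset.card_univ, Fintype.card_fin] at h
  rw [← h, eulerianPoly, listingPoly, ← Finset.sum_filter]
  refine Finset.sum_bij (fun σ _ => ⇑σ) ?_ ?_ ?_ ?_
  · intro σ _
    exact Finset.mem_filter.2 ⟨Finset.mem_univ _, σ.injective,
      Finset.image_univ_of_surjective σ.surjective⟩
  · intro σ _ τ _ hστ
    exact DFunLike.coe_injective hστ
  · intro w hw
    have hinj := (Finset.mem_filter.1 hw).2.1
    exact ⟨Equiv.ofBijective w (Finite.injective_iff_bijective.1 hinj), Finset.mem_univ _, rfl⟩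
  · intro σ _
    rfl

end Eulerian

section Counting

variable {n : ℕ} {b : ℕ → ℕ}

open Classical in
/-- The chains of sets with bottom element `∅` and top element `U`. -/
noncomputable def chainsTo (U : Finset (Fin n)) : Finset (Finset (Finset (Fin n))) :=
  Finset.univ.filter fun 𝒞 => IsFlag 𝒞 ∅ ∧ U ∈ 𝒞 ∧ ∀ C ∈ 𝒞, C ⊆ U

lemma mem_chainsTo {U : Finset (Fin n)} {𝒞 : Finset (Finset (Fin n))} :
    𝒞 ∈ chainsTo U ↔ IsFlag 𝒞 ∅ ∧ U ∈ 𝒞 ∧ ∀ C ∈ 𝒞, C ⊆ U := by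
  simp [chainsTo]

lemma eq_of_mem_chainsTo {U V : Finset (Fin n)} {𝒞 : Finset (Finset (Fin n))}
    (hU : 𝒞 ∈ chainsTo U) (hV : 𝒞 ∈ chainsTo V) : U = V :=
  have hU := mem_chainsTo.1 hU
  have hV := mem_chainsTo.1 hV
  (hV.2.2 U hU.2.1).antisymm (hU.2.2 V hV.2.1)

lemma isFlag_of_mem_chainsTo {U N : Finset (Fin n)} {𝒞 : Finset (Finset (Fin n))}
    (h : 𝒞 ∈ chainsTo U) (hN : Disjoint U N) : IsFlag 𝒞 N :=
  have h := mem_chainsTo.1 h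
  ⟨h.1.1, h.1.2.1, fun C hC => hN.mono_left (h.2.2 C hC)⟩

lemma card_le_of_mem_chainsTo {U : Finset (Fin n)} {𝒞 : Finset (Finset (Fin n))}
    (h : 𝒞 ∈ chainsTo U) : 𝒞.card ≤ U.card + 1 := by
  have h₁ := (isFlag_of_mem_chainsTo h disjoint_compl_right).finrank_flagDirection_add_le
  rw [Finset.card_compl, Fintype.card_fin] at h₁
  have h₂ := Finset.card_le_univ U
  rw [Fintype.card_fin] at h₂
  omega

lemma exists_mem_chainsTo {N : Finset (Fin n)} {𝒞 : Finset (Finset (Fin n))}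
    (h : IsFlag 𝒞 N) : ∃ U, Disjoint U N ∧ 𝒞 ∈ chainsTo U := by
  obtain ⟨U, hU, htop⟩ := h.exists_top subset_rfl ⟨∅, h.1⟩
  exact ⟨U, h.2.2 U hU,
    mem_chainsTo.2 ⟨h.mono subset_rfl h.1 (Finset.empty_subset N), hU, htop⟩⟩

lemma notMem_of_mem_chainsTo {U C : Finset (Fin n)} {𝒞 : Finset (Finset (Fin n))}
    (h : 𝒞 ∈ chainsTo C) (hCU : C ⊂ U) : U ∉ 𝒞 := fun hU =>
  hCU.2 ((mem_chainsTo.1 h).2.2 U hU)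

lemma insert_mem_chainsTo {U C : Finset (Fin n)} {𝒞 : Finset (Finset (Fin n))}
    (h : 𝒞 ∈ chainsTo C) (hCU : C ⊆ U) : insert U 𝒞 ∈ chainsTo U := by
  have h' := mem_chainsTo.1 h
  have hsub : ∀ D ∈ 𝒞, D ⊆ U := fun D hD => (h'.2.2 D hD).trans hCU
  refine mem_chainsTo.2 ⟨h'.1.insert_left (fun D hD => Or.inr (hsub D hD)) (by simp),
    Finset.mem_insert_self _ _, fun D hD => ?_⟩
  rcases Finset.mem_insert.1 hD with rfl | hD
  exacts [subset_rfl, hsub D hD]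

lemma erase_mem_chainsTo {U : Finset (Fin n)} {𝒞 : Finset (Finset (Fin n))}
    (h : 𝒞 ∈ chainsTo U) (hU : U.Nonempty) : ∃ C ⊂ U, 𝒞.erase U ∈ chainsTo C := by
  have h' := mem_chainsTo.1 h
  obtain ⟨C, -, hC⟩ := exists_mem_chainsTo (h'.1.mono (Finset.erase_subset U 𝒞)
    (Finset.mem_erase.2 ⟨hU.ne_empty.symm, h'.1.1⟩) subset_rfl)
  obtain ⟨hCU, hC𝒞⟩ := Finset.mem_erase.1 (mem_chainsTo.1 hC).2.1
  exact ⟨C, lt_of_le_of_ne (h'.2.2 C hC𝒞) hCU, hC⟩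

/-- The generating polynomial of the chains from `∅` to `U`. -/
noncomputable def chainPoly (U : Finset (Fin n)) : ℤ[X] :=
  ∑ 𝒞 ∈ chainsTo U, (X - 1) ^ (U.card + 1 - 𝒞.card)

lemma chainPoly_empty : chainPoly (∅ : Finset (Fin n)) = 1 := by
  have h : chainsTo (∅ : Finset (Fin n)) = {{∅}} := by
    ext 𝒞
    rw [mem_chainsTo, Finset.mem_singleton, Finset.eq_singleton_iff_unique_mem]
    constructor
    · exact fun h => ⟨h.2.1, fun C hC => Finset.subset_empty.1 (h.2.2 C hC)⟩
    · rintro ⟨h0, h⟩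
      obtain rfl := Finset.eq_singleton_iff_unique_mem.2 ⟨h0, h⟩
      exact ⟨⟨h0, by simp, by simp⟩, h0, by simp⟩
  simp [chainPoly, h]

lemma chainPoly_eq_sum_ssubsets {U : Finset (Fin n)} (hU : U.Nonempty) :
    chainPoly U = ∑ C ∈ U.ssubsets, (X - 1) ^ (U.card - C.card - 1) * chainPoly C := by
  simp only [chainPoly, Finset.mul_sum]
  rw [Finset.sum_sigma']
  symm
  refine Finset.sum_bij (fun p _ => insert U p.2) ?_ ?_ ?_ ?_
  · rintro ⟨C, 𝒞⟩ hp
    obtain ⟨hC, h𝒞⟩ := Finset.mem_sigma.1 hp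
    exact insert_mem_chainsTo h𝒞 (Finset.mem_ssubsets.1 hC).subset
  · rintro ⟨C, 𝒞⟩ hp ⟨D, 𝒟⟩ hq heq
    obtain ⟨hC, h𝒞⟩ := Finset.mem_sigma.1 hp
    obtain ⟨hD, h𝒟⟩ := Finset.mem_sigma.1 hq
    have h₁ := notMem_of_mem_chainsTo h𝒞 (Finset.mem_ssubsets.1 hC)
    have h₂ := notMem_of_mem_chainsTo h𝒟 (Finset.mem_ssubsets.1 hD)
    have h₃ := congrArg (fun s => Finset.erase s U) heq
    simp only [Finset.erase_insert h₁, Finset.erase_insert h₂] at h₃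
    subst h₃
    obtain rfl := eq_of_mem_chainsTo h𝒞 h𝒟
    rfl
  · intro 𝒞 h𝒞
    obtain ⟨C, hCU, hC⟩ := erase_mem_chainsTo h𝒞 hU
    exact ⟨⟨C, 𝒞.erase U⟩, Finset.mem_sigma.2 ⟨Finset.mem_ssubsets.2 hCU, hC⟩,
      Finset.insert_erase (mem_chainsTo.1 h𝒞).2.1⟩
  · rintro ⟨C, 𝒞⟩ hp
    obtain ⟨hC, h𝒞⟩ := Finset.mem_sigma.1 hp
    have hCU := Finset.mem_ssubsets.1 hC
    have h₁ := card_le_of_mem_chainsTo h𝒞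
    have h₂ := Finset.card_lt_card hCU
    dsimp only at h₁ h₂ ⊢
    rw [Finset.card_insert_of_notMem (s := 𝒞) (notMem_of_mem_chainsTo h𝒞 hCU), ← pow_add]
    congr 1
    omega

lemma chainPoly_eq (U : Finset (Fin n)) : chainPoly U = eulerianPoly U.card := by
  rw [eulerianPoly_eq_ordPartitionPoly]
  exact eq_ordPartitionPoly chainPoly chainPoly_empty
    (fun U hU => chainPoly_eq_sum_ssubsets hU) U

lemma sum_powerset_mul_eulerianPoly (W : Finset (Fin n)) :
    ∑ U ∈ W.powerset, (X - 1) ^ (W.card - U.card) * eulerianPoly U.card =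
      if W.card = 0 then 1 else X * eulerianPoly W.card := by
  rcases W.eq_empty_or_nonempty with rfl | hW
  · simp [eulerianPoly_eq_ordPartitionPoly, ordPartitionPoly]
  · rw [if_neg hW.card_pos.ne', ← Finset.insert_erase (Finset.mem_powerset_self W),
      Finset.sum_insert (Finset.notMem_erase _ _)]
    change _ + ∑ U ∈ W.ssubsets, _ = _
    have h : ∑ U ∈ W.ssubsets, (X - 1) ^ (W.card - U.card) * eulerianPoly U.card =
        (X - 1) * eulerianPoly W.card := by
      simp only [eulerianPoly_eq_ordPartitionPoly]
      rw [ordPartitionPoly_card hW, Finset.mul_sum]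
      refine Finset.sum_congr rfl fun C hC => ?_
      have := Finset.card_lt_card (Finset.mem_ssubsets.1 hC)
      rw [← mul_assoc, ← pow_succ']
      congr 2
      omega
    rw [h, Nat.sub_self]
    ring

lemma sum_isFlag_left [DecidablePred fun p : Finset (Finset (Fin n)) × Finset (Fin n) =>
      IsFlag p.1 p.2] :
    ∑ p : Finset (Finset (Fin n)) × Finset (Fin n) with IsFlag p.1 p.2,
      (X - 1 : ℤ[X]) ^ (n + 1 - p.1.card - p.2.card) = binomialEulerianPoly n := by
  classical
  have h₁ : ∑ p : Finset (Finset (Fin n)) × Finset (Fin n) with IsFlag p.1 p.2,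
      (X - 1 : ℤ[X]) ^ (n + 1 - p.1.card - p.2.card) =
      ∑ N : Finset (Fin n), ∑ U ∈ Nᶜ.powerset,
        (X - 1) ^ (Nᶜ.card - U.card) * eulerianPoly U.card := by
    simp only [← chainPoly_eq, chainPoly, Finset.mul_sum]
    simp only [Finset.sum_sigma']
    symm
    refine Finset.sum_bij (fun q _ => (q.2.2, q.1)) ?_ ?_ ?_ ?_
    · rintro ⟨N, U, 𝒞⟩ hq
      simp only [Finset.mem_sigma, Finset.mem_univ, true_and, Finset.mem_powerset] at hq
      exact Finset.mem_filter.2 ⟨Finset.mem_univ _, isFlag_of_mem_chainsTo hq.2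
        (Finset.subset_compl_iff_disjoint_right.1 hq.1)⟩
    · rintro ⟨N, U, 𝒞⟩ hq ⟨N', U', 𝒞'⟩ hq' heq
      simp only [Finset.mem_sigma] at hq hq'
      simp only [Prod.mk.injEq] at heq
      obtain ⟨rfl, rfl⟩ := heq
      obtain rfl := eq_of_mem_chainsTo hq.2.2 hq'.2.2
      rfl
    · rintro ⟨𝒞, N⟩ hp
      obtain ⟨U, hUN, hU⟩ := exists_mem_chainsTo (Finset.mem_filter.1 hp).2
      refine ⟨⟨N, U, 𝒞⟩, ?_, rfl⟩
      simp only [Finset.mem_sigma, Finset.mem_univ, true_and, Finset.mem_powerset]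
      exact ⟨Finset.subset_compl_iff_disjoint_right.2 hUN, hU⟩
    · rintro ⟨N, U, 𝒞⟩ hq
      simp only [Finset.mem_sigma, Finset.mem_univ, true_and, Finset.mem_powerset] at hq
      have h₁ := card_le_of_mem_chainsTo hq.2
      have h₂ := Finset.card_le_card hq.1
      have h₃ := Finset.card_le_univ N
      rw [Finset.card_compl] at h₂
      rw [Fintype.card_fin] at h₂ h₃
      simp only
      rw [← pow_add, Finset.card_compl, Fintype.card_fin]
      congr 1
      omega
  rw [h₁]
  simp only [sum_powerset_mul_eulerianPoly]
  have h₂ : (∑ N : Finset (Fin n), if Nᶜ.card = 0 then (1 : ℤ[X]) else X * eulerianPoly Nᶜ.card) =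
      ∑ W : Finset (Fin n), if W.card = 0 then 1 else X * eulerianPoly W.card :=
    Equiv.sum_comp (compl_involutive (α := Finset (Fin n))).toPerm
      fun W => if W.card = 0 then (1 : ℤ[X]) else X * eulerianPoly W.card
  rw [h₂, ← Finset.powerset_univ,
    Finset.sum_powerset_apply_card (fun k => if k = 0 then 1 else X * eulerianPoly k),
    Finset.card_univ, Fintype.card_fin, binomialEulerianPoly, Finset.sum_range_succ',
    add_comm, Finset.mul_sum]
  congr 1
  · simp
  · rw [Finset.range_eq_Ico, Finset.sum_Ico_add' (fun k => n.choose k •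
      if k = 0 then (1 : ℤ[X]) else X * eulerianPoly k) 0 n 1]
    refine Finset.sum_congr (by ext; simp) fun k hk => ?_
    have : k ≠ 0 := by
      have := (Finset.mem_Icc.1 hk).1
      omega
    rw [if_neg this, nsmul_eq_mul]
    ring

lemma compl_singleton_ssubset_univ (i : Fin n) : ({i}ᶜ : Finset (Fin n)) ⊂ Finset.univ :=
  Finset.ssubset_univ_iff.2 (by simp [Finset.compl_eq_univ_iff])

lemma card_compl_singleton_add_one (i : Fin n) :
    ({i}ᶜ : Finset (Fin n)).card + 1 = n := by
  have := i.pos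
  rw [Finset.card_compl, Finset.card_singleton, Fintype.card_fin]
  omega

lemma exists_mem_chainsTo_compl {𝒞 : Finset (Finset (Fin n))} {N : Finset (Fin n)}
    (h : IsFlag 𝒞 N) {i : Fin n} (hi : {i}ᶜ ∈ 𝒞) (hiN : i ∉ N) :
    N = ∅ ∧ (𝒞 ∈ chainsTo {i}ᶜ ∨
      Finset.univ ∈ 𝒞 ∧ 𝒞.erase Finset.univ ∈ chainsTo {i}ᶜ) := by
  have hN : N = ∅ := by
    refine Finset.eq_empty_of_forall_notMem fun j hj => ?_
    by_cases hji : j = i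
    · exact hiN (hji ▸ hj)
    · exact Finset.disjoint_left.1 (h.2.2 _ hi) (by simpa using hji) hj
  subst hN
  refine ⟨rfl, ?_⟩
  have hcard := card_compl_singleton_add_one i
  have key : ∀ {U 𝒟}, 𝒟 ∈ chainsTo U → U ≠ Finset.univ → {i}ᶜ ∈ 𝒟 → 𝒟 ∈ chainsTo {i}ᶜ := by
    intro U 𝒟 hU hU1 hmem
    have hsub := (mem_chainsTo.1 hU).2.2 _ hmem
    have hlt := Finset.card_lt_card (Finset.ssubset_univ_iff.2 hU1)
    rw [Finset.card_univ, Fintype.card_fin] at hlt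
    rwa [Finset.eq_of_subset_of_card_le hsub (by omega)]
  obtain ⟨U, -, hU⟩ := exists_mem_chainsTo h
  by_cases hU1 : U = Finset.univ
  · subst hU1
    obtain ⟨C, hC, hC'⟩ := erase_mem_chainsTo hU ⟨i, Finset.mem_univ i⟩
    exact Or.inr ⟨(mem_chainsTo.1 hU).2.1, key hC' hC.ne
      (Finset.mem_erase.2 ⟨(compl_singleton_ssubset_univ i).ne, hi⟩)⟩
  · exact Or.inl (key hU hU1 hi)

lemma sum_isFlag_bad [DecidablePred fun p : Finset (Finset (Fin n)) × Finset (Fin n) =>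
      IsFlag p.1 p.2 ∧ ∃ i, {i}ᶜ ∈ p.1 ∧ i ∉ p.2] :
    ∑ p : Finset (Finset (Fin n)) × Finset (Fin n) with
        IsFlag p.1 p.2 ∧ ∃ i, {i}ᶜ ∈ p.1 ∧ i ∉ p.2,
      (X - 1 : ℤ[X]) ^ (n + 1 - p.1.card - p.2.card) =
      (n : ℤ[X]) * X * eulerianPoly (n - 1) := by
  classical
  have h₁ : ∑ i : Fin n, ∑ 𝒞 ∈ chainsTo ({i}ᶜ : Finset (Fin n)), ∑ s : Bool,
      (X - 1 : ℤ[X]) ^ (({i}ᶜ : Finset (Fin n)).card + 1 - 𝒞.card + if s then 1 else 0) =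
      (n : ℤ[X]) * X * eulerianPoly (n - 1) := by
    have : ∀ i : Fin n, ∑ 𝒞 ∈ chainsTo ({i}ᶜ : Finset (Fin n)), ∑ s : Bool,
        (X - 1 : ℤ[X]) ^ (({i}ᶜ : Finset (Fin n)).card + 1 - 𝒞.card + if s then 1 else 0) =
        X * eulerianPoly (n - 1) := by
      intro i
      have hn : n - 1 = ({i}ᶜ : Finset (Fin n)).card := by
        have := card_compl_singleton_add_one i
        omega
      rw [hn, ← chainPoly_eq, chainPoly, Finset.mul_sum]
      refine Finset.sum_congr rfl fun 𝒞 _ => ?_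
      simp only [Fintype.sum_bool, if_true, Bool.false_eq_true, if_false, pow_succ, add_zero]
      ring
    simp only [this, Finset.sum_const, Finset.card_univ, Fintype.card_fin, nsmul_eq_mul]
    ring
  rw [← h₁]
  simp only [Finset.sum_sigma']
  symm
  refine Finset.sum_bij
    (fun q _ => ((if q.2.2 then q.2.1 else insert Finset.univ q.2.1), ∅)) ?_ ?_ ?_ ?_
  · rintro ⟨i, 𝒞, s⟩ hq
    simp only [Finset.mem_sigma, Finset.mem_univ, true_and, and_true] at hq
    have hi := (mem_chainsTo.1 hq).2.1
    refine Finset.mem_filter.2 ⟨Finset.mem_univ _, ?_, i, ?_, by simp⟩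
    · cases s
      · exact (mem_chainsTo.1 (insert_mem_chainsTo hq (Finset.subset_univ _))).1
      · exact (mem_chainsTo.1 hq).1
    · cases s
      · exact Finset.mem_insert_of_mem hi
      · exact hi
  · rintro ⟨i, 𝒞, s⟩ hq ⟨j, 𝒟, s'⟩ hq' heq
    simp only [Finset.mem_sigma, Finset.mem_univ, true_and, and_true] at hq hq'
    have h𝒞 := notMem_of_mem_chainsTo hq (compl_singleton_ssubset_univ i)
    have h𝒟 := notMem_of_mem_chainsTo hq' (compl_singleton_ssubset_univ j)
    have heq := congrArg Prod.fst heq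
    have hs : s = s' := by
      cases s <;> cases s'
      · rfl
      · exact absurd (heq.subset (Finset.mem_insert_self Finset.univ 𝒞)) h𝒟
      · exact absurd (heq.superset (Finset.mem_insert_self Finset.univ 𝒟)) h𝒞
      · rfl
    subst hs
    have h𝒞𝒟 : 𝒞 = 𝒟 := by
      cases s
      · have h₃ := congrArg (fun s => Finset.erase s Finset.univ) heq
        simpa [Finset.erase_insert h𝒞, Finset.erase_insert h𝒟] using h₃
      · simpa using heq
    subst h𝒞𝒟
    obtain rfl : i = j := by simpa using eq_of_mem_chainsTo hq hq'
    rfl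
  · rintro ⟨𝒞, N⟩ hp
    obtain ⟨-, h, i, hi, hiN⟩ := Finset.mem_filter.1 hp
    obtain ⟨rfl, h𝒞 | ⟨h1, h𝒞⟩⟩ : N = ∅ ∧ _ := exists_mem_chainsTo_compl h hi hiN
    · exact ⟨⟨i, 𝒞, true⟩, by simpa using h𝒞, by simp⟩
    · exact ⟨⟨i, 𝒞.erase Finset.univ, false⟩, by simpa using h𝒞,
        by simp [Finset.insert_erase h1]⟩
  · rintro ⟨i, 𝒞, s⟩ hq
    simp only [Finset.mem_sigma, Finset.mem_univ, true_and, and_true] at hq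
    have h𝒞 := notMem_of_mem_chainsTo hq (compl_singleton_ssubset_univ i)
    have hcard := card_le_of_mem_chainsTo hq
    rw [card_compl_singleton_add_one] at hcard
    simp only [card_compl_singleton_add_one]
    congr 1
    cases s
    · simp [Finset.card_insert_of_notMem h𝒞]
    · simp only [if_true, Finset.card_empty]
      omega

open Classical in
lemma sum_faceCount (hb : ∀ j < n, 1 ≤ b j) :
    ∑ i ∈ Finset.range (n + 1), (faceCount n b i : ℤ[X]) * (X - 1) ^ i =
      ∑ p : Finset (Finset (Fin n)) × Finset (Fin n) with IsGoodFlag b p.1 p.2,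
        (X - 1 : ℤ[X]) ^ (n + 1 - p.1.card - p.2.card) := by
  set 𝒢 := Finset.univ.filter
    fun p : Finset (Finset (Fin n)) × Finset (Fin n) => IsGoodFlag b p.1 p.2 with h𝒢
  have hmem : ∀ p, p ∈ 𝒢 ↔ IsGoodFlag b p.1 p.2 := fun p => by simp [h𝒢]
  have hcount : ∀ i, faceCount n b i =
      (𝒢.filter fun p => n + 1 - p.1.card - p.2.card = i).card := by
    intro i
    have hset : {F : Set (Fin n → ℝ) | F.Nonempty ∧ IsExposed ℝ (bpfPolytope n b) F ∧
        Module.finrank ℝ (vectorSpan ℝ F) = i} =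
        (fun p : Finset (Finset (Fin n)) × Finset (Fin n) => flagFace b p.1 p.2) ''
          (𝒢.filter fun p => n + 1 - p.1.card - p.2.card = i :
            Finset (Finset (Finset (Fin n)) × Finset (Fin n))) := by
      ext F
      constructor
      · rintro ⟨hne, hexp, hdim⟩
        obtain ⟨𝒞, N, hgood, rfl⟩ := exists_isGoodFlag_of_isExposed hb hne hexp
        refine ⟨(𝒞, N), ?_, rfl⟩
        have := hgood.finrank_vectorSpan_add hb
        refine Finset.mem_coe.2 (Finset.mem_filter.2 ⟨(hmem _).2 hgood, ?_⟩)
        simp only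
        omega
      · rintro ⟨⟨𝒞, N⟩, hp, rfl⟩
        obtain ⟨hp, hi⟩ := Finset.mem_filter.1 (Finset.mem_coe.1 hp)
        have hgood := (hmem _).1 hp
        have := hgood.finrank_vectorSpan_add hb
        refine ⟨hgood.1.flagFace_nonempty hb, hgood.1.isExposed_flagFace hb, ?_⟩
        simp only at hi this ⊢
        omega
    rw [faceCount, hset, Set.InjOn.ncard_image, Set.ncard_coe_finset]
    rintro ⟨𝒞, N⟩ hp ⟨𝒞', N'⟩ hp' heq
    have hp := (hmem _).1 (Finset.mem_filter.1 (Finset.mem_coe.1 hp)).1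
    have hp' := (hmem _).1 (Finset.mem_filter.1 (Finset.mem_coe.1 hp')).1
    obtain ⟨h₁, h₂⟩ := hp.eq_of_flagFace_eq hb hp' heq
    exact Prod.ext h₁ h₂
  rw [← Finset.sum_fiberwise_of_maps_to (s := 𝒢) (t := Finset.range (n + 1))
    (g := fun p : Finset (Finset (Fin n)) × Finset (Fin n) => n + 1 - p.1.card - p.2.card)]
  · refine Finset.sum_congr rfl fun i _ => ?_
    rw [Finset.sum_congr rfl fun p hp => by rw [(Finset.mem_filter.1 hp).2],
      Finset.sum_const, hcount, nsmul_eq_mul]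
  · intro p hp
    have := Finset.card_pos.2 ⟨_, ((hmem p).1 hp).1.1⟩
    rw [Finset.mem_range]
    omega

end Counting

/-- The `h`-polynomial `h(X_n(b); z) = f(X_n(b); z-1)` equals `Ã_n(z)` when
`b_1 ≥ 2` and `Ã_n(z) - n·z·A_{n-1}(z)` when `b_1 = 1`. -/
theorem h_polynomial_of_bpfPolytope (n : ℕ) (b : ℕ → ℕ) (hb : ∀ j < n, 1 ≤ b j) :
    (2 ≤ b 0 →
      ∑ i ∈ Finset.range (n + 1), (faceCount n b i : Polynomial ℤ) * (X - 1) ^ i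
        = binomialEulerianPoly n) ∧
    (b 0 = 1 →
      ∑ i ∈ Finset.range (n + 1), (faceCount n b i : Polynomial ℤ) * (X - 1) ^ i
        = binomialEulerianPoly n - (n : Polynomial ℤ) * X * eulerianPoly (n - 1)) := by
  classical
  rw [sum_faceCount hb]
  have hflags := sum_isFlag_left (n := n)
  constructor
  · intro hb0
    rw [← hflags]
    refine Finset.sum_congr (Finset.filter_congr fun p _ => ?_) fun _ _ => rfl
    exact ⟨fun h => h.1, fun h => ⟨h, fun h1 => by omega⟩⟩
  · intro hb0
    rw [eq_sub_iff_add_eq, ← sum_isFlag_bad, ← hflags,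
      ← Finset.sum_filter_add_sum_filter_not (Finset.univ.filter
        fun p : Finset (Finset (Fin n)) × Finset (Fin n) => IsFlag p.1 p.2)
        (fun p : Finset (Finset (Fin n)) × Finset (Fin n) => IsGoodFlag b p.1 p.2),
      Finset.filter_filter, Finset.filter_filter]
    congr 1
    · refine Finset.sum_congr (Finset.filter_congr fun p _ => ?_) fun _ _ => rfl
      exact ⟨fun h => ⟨h.1, h⟩, fun h => h.2⟩
    · refine Finset.sum_congr (Finset.filter_congr fun p _ => ?_) fun _ _ => rfl
      refine and_congr_right fun h => ?_
      simp [IsGoodFlag, h, hb0]
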